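/- Let p, ε, and the complete genus representatives T₁, …, T_h and S₁, …, S_k be exactly as in the Eichler Anzahlmatrix relation setting: the T_i are pairwise non-ℤ-equivalent positive definite half-integral ternary forms forming a complete set of class representatives of a genus with Gram matrices ℤ_p-equivalent to H ⊕ [ε], and the S_j form a complete set of class representatives of the genus with Gram matrices ℤ_p-equivalent to H ⊕ [pε] and ℤ_q-equivalent to p·Gram(T₁) for q ≠ p. Then the matrix π := (r(pT_i, T_j)/o(T_i) − δ_{ij}) ∈ M_h(ℚ) has −(p+1) as an eigenvalue if and only if the h×k matrix 𝔐 := (r(T_i^p, S_j)/o(T_i)) has rank strictly less than h. -/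

import Mathlib

open Matrix

noncomputable section

/-- The image of an integral matrix in the rational matrices. -/
def intMap (X : Matrix (Fin 3) (Fin 3) ℤ) : Matrix (Fin 3) (Fin 3) ℚ :=
  X.map fun a => (a : ℚ)

/-- The value of the quadratic form with Gram matrix `A` at an integral vector `x`. -/
def qf (A : Matrix (Fin 3) (Fin 3) ℚ) (x : Fin 3 → ℤ) : ℚ :=
  (fun i => (x i : ℚ)) ⬝ᵥ A.mulVec fun i => (x i : ℚ)

/-- A rational symmetric matrix is half-integral: integral diagonal, off-diagonal in (1/2)ℤ. -/
def HalfIntegral (A : Matrix (Fin 3) (Fin 3) ℚ) : Prop :=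
  (∀ i, ∃ n : ℤ, A i i = n) ∧ ∀ i j, ∃ n : ℤ, 2 * A i j = n

/-- `A` is symmetric and positive definite. -/
def PosDef3 (A : Matrix (Fin 3) (Fin 3) ℚ) : Prop :=
  A.IsSymm ∧ ∀ x : Fin 3 → ℚ, x ≠ 0 → 0 < x ⬝ᵥ A.mulVec x

/-- `r(K, L)`: the number of representations of the form with Gram matrix `A` by the form
with Gram matrix `B`. -/
def repNum (A B : Matrix (Fin 3) (Fin 3) ℚ) : ℕ :=
  Nat.card {X : Matrix (Fin 3) (Fin 3) ℤ // (intMap X)ᵀ * B * intMap X = A}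

/-- `o(L)`: the number of integral automorphs of the form with Gram matrix `A`. -/
def autNum (A : Matrix (Fin 3) (Fin 3) ℚ) : ℕ :=
  Nat.card {X : Matrix (Fin 3) (Fin 3) ℤ // IsUnit X.det ∧ (intMap X)ᵀ * A * intMap X = A}

/-- `r(n, f)`: the number of representations of the integer `n` by the form with
Gram matrix `A`. -/
def rEval (A : Matrix (Fin 3) (Fin 3) ℚ) (n : ℤ) : ℕ :=
  Nat.card {x : Fin 3 → ℤ // qf A x = (n : ℚ)}

/-- ℤ-equivalence of Gram matrices. -/
def ZEquiv (A B : Matrix (Fin 3) (Fin 3) ℚ) : Prop :=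
  ∃ X : Matrix (Fin 3) (Fin 3) ℤ, IsUnit X.det ∧ (intMap X)ᵀ * A * intMap X = B

/-- The Watson set `Λ_p(A) = {x ∈ ℤ³ : f_A(x + z) ≡ f_A(z) (mod p) for all z ∈ ℤ³}`. -/
def LamSet (p : ℕ) (A : Matrix (Fin 3) (Fin 3) ℚ) : Set (Fin 3 → ℤ) :=
  {x | ∀ z : Fin 3 → ℤ, ∃ k : ℤ, qf A (x + z) - qf A z = (p : ℚ) * k}

/-- ℤ_q-equivalence of rational Gram matrices (inside ℚ_q). -/
def ZqEquiv (q : ℕ) [Fact q.Prime] (A B : Matrix (Fin 3) (Fin 3) ℚ) : Prop :=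
  ∃ X : Matrix (Fin 3) (Fin 3) ℤ_[q], IsUnit X.det ∧
    (X.map fun a => (a : ℚ_[q]))ᵀ * A.map (fun a => (a : ℚ_[q])) * X.map (fun a => (a : ℚ_[q]))
      = B.map fun a => (a : ℚ_[q])

/-- ℤ_q-equivalence of a rational Gram matrix to a q-adic target matrix. -/
def ZpEquivTo (q : ℕ) [Fact q.Prime] (A : Matrix (Fin 3) (Fin 3) ℚ)
    (B : Matrix (Fin 3) (Fin 3) ℚ_[q]) : Prop :=
  ∃ X : Matrix (Fin 3) (Fin 3) ℤ_[q], IsUnit X.det ∧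
    (X.map fun a => (a : ℚ_[q]))ᵀ * A.map (fun a => (a : ℚ_[q])) * X.map (fun a => (a : ℚ_[q])) = B

/-- The block diagonal matrix `H ⊕ [c]` with `H = [[0,1/2],[1/2,0]]`. -/
def Hblock (q : ℕ) [Fact q.Prime] (c : ℚ_[q]) : Matrix (Fin 3) (Fin 3) ℚ_[q] :=
  !![0, 1/2, 0; 1/2, 0, 0; 0, 0, c]

lemma intMap_mul (X Y : Matrix (Fin 3) (Fin 3) ℤ) : intMap (X * Y) = intMap X * intMap Y :=
  map_mul (Int.castRingHom ℚ).mapMatrix X Y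

lemma intMap_one : intMap 1 = 1 :=
  map_one (Int.castRingHom ℚ).mapMatrix

lemma intMap_smul (a : ℤ) (X : Matrix (Fin 3) (Fin 3) ℤ) :
    intMap (a • X) = (a : ℚ) • intMap X := by
  ext i j
  simp only [intMap, Matrix.map_apply, Matrix.smul_apply, smul_eq_mul, Int.cast_mul]

lemma det_intMap (X : Matrix (Fin 3) (Fin 3) ℤ) : (intMap X).det = X.det :=
  ((Int.castRingHom ℚ).map_det X).symm

lemma intMap_injective : Function.Injective intMap := fun X Y h => by
  ext i j
  have := congrFun (congrFun h i) j
  simpa [intMap] using this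

lemma intMap_mulVec (X : Matrix (Fin 3) (Fin 3) ℤ) (v : Fin 3 → ℤ) :
    (intMap X).mulVec (fun i => (v i : ℚ)) = fun i => ((X.mulVec v) i : ℚ) := by
  ext i
  simp [intMap, Matrix.mulVec, dotProduct]

/-- The change of basis formula for the values of a quadratic form. -/
lemma qf_mulVec (A : Matrix (Fin 3) (Fin 3) ℚ) (X : Matrix (Fin 3) (Fin 3) ℤ) (v : Fin 3 → ℤ) :
    qf A (X.mulVec v) = qf ((intMap X)ᵀ * A * intMap X) v := by
  unfold qf
  rw [← intMap_mulVec, ← Matrix.mulVec_mulVec, ← Matrix.mulVec_mulVec, Matrix.mulVec_transpose,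
    dotProduct_comm _ (Matrix.vecMul _ _), ← Matrix.dotProduct_mulVec, dotProduct_comm]

lemma qf_smul (a : ℚ) (A : Matrix (Fin 3) (Fin 3) ℚ) (v : Fin 3 → ℤ) :
    qf (a • A) v = a * qf A v := by
  simp [qf, Matrix.smul_mulVec]

lemma qf_smul_vec (a : ℤ) (A : Matrix (Fin 3) (Fin 3) ℚ) (v : Fin 3 → ℤ) :
    qf A (a • v) = (a : ℚ) ^ 2 * qf A v := by
  simp [qf, Matrix.mulVec, dotProduct, Fin.sum_univ_three]
  ring

lemma HalfIntegral.exists_qf_eq {A : Matrix (Fin 3) (Fin 3) ℚ} (hs : A.IsSymm)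
    (h : HalfIntegral A) (v : Fin 3 → ℤ) : ∃ n : ℤ, qf A v = n := by
  obtain ⟨a, ha⟩ := h.1 0
  obtain ⟨b, hb⟩ := h.1 1
  obtain ⟨c, hc⟩ := h.1 2
  obtain ⟨d, hd⟩ := h.2 0 1
  obtain ⟨e, he⟩ := h.2 0 2
  obtain ⟨f, hf⟩ := h.2 1 2
  refine ⟨a * v 0 ^ 2 + b * v 1 ^ 2 + c * v 2 ^ 2 + d * v 0 * v 1 + e * v 0 * v 2
    + f * v 1 * v 2, ?_⟩
  push_cast
  rw [← ha, ← hb, ← hc, ← hd, ← he, ← hf]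
  simp only [qf, Matrix.mulVec, dotProduct, Fin.sum_univ_three, hs.apply 0 1, hs.apply 0 2,
    hs.apply 1 2]
  ring

lemma halfIntegral_of_qf {A : Matrix (Fin 3) (Fin 3) ℚ} (hs : A.IsSymm)
    (h : ∀ v, ∃ n : ℤ, qf A v = n) : HalfIntegral A := by
  have key (i : Fin 3) : qf A (Pi.single i 1) = A i i := by
    fin_cases i <;> simp [qf, Matrix.mulVec, dotProduct, Pi.single_apply]
  have key2 (i j : Fin 3) :
      qf A (Pi.single i 1 + Pi.single j 1) = A i i + 2 * A i j + A j j := by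
    have h01 := hs.apply 0 1
    have h02 := hs.apply 0 2
    have h12 := hs.apply 1 2
    fin_cases i <;> fin_cases j <;>
      simp [qf, Matrix.mulVec, dotProduct, Fin.sum_univ_three, Pi.single_apply] <;> linarith
  refine ⟨fun i => ?_, fun i j => ?_⟩
  · obtain ⟨n, hn⟩ := h (Pi.single i 1)
    exact ⟨n, by rw [← hn, key]⟩
  · obtain ⟨n, hn⟩ := h (Pi.single i 1)
    obtain ⟨m, hm⟩ := h (Pi.single j 1)
    obtain ⟨r, hr⟩ := h (Pi.single i 1 + Pi.single j 1)
    refine ⟨r - n - m, ?_⟩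
    push_cast
    rw [← hr, ← hn, ← hm, key, key, key2]
    ring

lemma PosDef3.isUnit_det {A : Matrix (Fin 3) (Fin 3) ℚ} (h : PosDef3 A) : IsUnit A.det := by
  rw [isUnit_iff_ne_zero]
  intro h0
  obtain ⟨v, hv, hv0⟩ := Matrix.exists_mulVec_eq_zero_iff.mpr h0
  have := h.2 v hv
  simp [hv0] at this

lemma PosDef3.cauchy_schwarz {A : Matrix (Fin 3) (Fin 3) ℚ} (h : PosDef3 A) (x y : Fin 3 → ℚ) :
    (y ⬝ᵥ A.mulVec x) ^ 2 ≤ (y ⬝ᵥ A.mulVec y) * (x ⬝ᵥ A.mulVec x) := by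
  have hnonneg (z : Fin 3 → ℚ) : 0 ≤ z ⬝ᵥ A.mulVec z := by
    rcases eq_or_ne z 0 with rfl | hz
    · simp
    · exact (h.2 z hz).le
  have hsymm : x ⬝ᵥ A.mulVec y = y ⬝ᵥ A.mulVec x := by
    rw [Matrix.dotProduct_mulVec, ← Matrix.mulVec_transpose, h.1.eq, dotProduct_comm]
  have hq (t : ℚ) :
      0 ≤ (y ⬝ᵥ A.mulVec y) * (t * t) + 2 * (y ⬝ᵥ A.mulVec x) * t + x ⬝ᵥ A.mulVec x := by
    have := hnonneg (t • y + x)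
    simp only [Matrix.mulVec_add, Matrix.mulVec_smul, dotProduct_add, add_dotProduct,
      smul_dotProduct, dotProduct_smul, smul_eq_mul, hsymm] at this
    linarith
  have := discrim_le_zero hq
  rw [discrim] at this
  nlinarith

/-- A positive definite form represents a given number only finitely often. -/
lemma PosDef3.finite_qf_eq {A : Matrix (Fin 3) (Fin 3) ℚ} (h : PosDef3 A) (c : ℚ) :
    {v : Fin 3 → ℤ | qf A v = c}.Finite := by
  have hb (i : Fin 3) : ∃ N : ℤ, ∀ v : Fin 3 → ℤ, qf A v = c → v i ^ 2 ≤ N := by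
    let y : Fin 3 → ℚ := A⁻¹.mulVec (Pi.single i 1)
    have hy : A.mulVec y = Pi.single i 1 := by
      rw [Matrix.mulVec_mulVec, Matrix.mul_nonsing_inv _ h.isUnit_det, Matrix.one_mulVec]
    refine ⟨⌈(y ⬝ᵥ A.mulVec y) * c⌉, fun v hv => ?_⟩
    have h1 := h.cauchy_schwarz y (fun i => (v i : ℚ))
    rw [hy, dotProduct_single, mul_one, mul_comm] at h1
    have h2 : ((v i ^ 2 : ℤ) : ℚ) ≤ (⌈(y ⬝ᵥ A.mulVec y) * c⌉ : ℤ) := by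
      refine le_trans ?_ (Int.le_ceil _)
      rw [hy]
      push_cast
      rw [← hv]
      exact h1
    exact_mod_cast h2
  choose N hN using hb
  refine (Set.Finite.pi' fun i => Set.finite_Icc (-N i) (N i)).subset fun v hv i => ?_
  have := hN i v hv
  rw [Set.mem_Icc]
  constructor <;> nlinarith [sq_nonneg (v i - 1), sq_nonneg (v i + 1), sq_nonneg (v i)]

lemma PosDef3.finite_rep {B : Matrix (Fin 3) (Fin 3) ℚ} (h : PosDef3 B)
    (A : Matrix (Fin 3) (Fin 3) ℚ) :
    Finite {X : Matrix (Fin 3) (Fin 3) ℤ // (intMap X)ᵀ * B * intMap X = A} := by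
  have hfin : {X : Fin 3 → Fin 3 → ℤ | ∀ i, X i ∈ {v | qf B v = A i i}}.Finite :=
    Set.Finite.pi' fun i => h.finite_qf_eq (A i i)
  refine Set.Finite.subset (hfin.preimage
    (f := fun X : Matrix (Fin 3) (Fin 3) ℤ => fun i j => X j i) ?_) ?_
  · intro X _ Y _ hXY
    ext i j
    exact congrFun (congrFun hXY j) i
  · intro X hX i
    have : (fun j => X j i) = X.mulVec (Pi.single i 1) := by
      ext j
      simp
    change qf B (fun j => X j i) = _
    rw [this, qf_mulVec, hX]
    fin_cases i <;> simp [qf, Matrix.mulVec, dotProduct, Pi.single_apply]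

lemma PosDef3.finite_aut {A : Matrix (Fin 3) (Fin 3) ℚ} (h : PosDef3 A) :
    Finite {X : Matrix (Fin 3) (Fin 3) ℤ // IsUnit X.det ∧ (intMap X)ᵀ * A * intMap X = A} :=
  haveI := h.finite_rep A
  Finite.of_injective (β := {X : Matrix (Fin 3) (Fin 3) ℤ // (intMap X)ᵀ * A * intMap X = A})
    (fun X => ⟨X.1, X.2.2⟩) fun _ _ hXY => Subtype.ext (congrArg (fun Z => Z.1) hXY)

lemma PosDef3.autNum_pos {A : Matrix (Fin 3) (Fin 3) ℚ} (h : PosDef3 A) : 0 < autNum A := by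
  have := h.finite_aut
  have : Nonempty {X : Matrix (Fin 3) (Fin 3) ℤ //
      IsUnit X.det ∧ (intMap X)ᵀ * A * intMap X = A} := ⟨1, by simp [intMap_one]⟩
  exact Nat.card_pos

lemma PosDef3.congr {A : Matrix (Fin 3) (Fin 3) ℚ} (h : PosDef3 A)
    {X : Matrix (Fin 3) (Fin 3) ℚ} (hX : IsUnit X.det) : PosDef3 (Xᵀ * A * X) := by
  refine ⟨by simp [Matrix.IsSymm, Matrix.transpose_mul, h.1.eq, Matrix.mul_assoc], fun x hx => ?_⟩
  have hx' : X.mulVec x ≠ 0 := fun h0 => hx <| by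
    rw [← Matrix.one_mulVec x, ← Matrix.nonsing_inv_mul X hX, ← Matrix.mulVec_mulVec, h0,
      Matrix.mulVec_zero]
  have := h.2 _ hx'
  rwa [← Matrix.mulVec_mulVec, ← Matrix.mulVec_mulVec, Matrix.mulVec_transpose,
    dotProduct_comm x, ← Matrix.dotProduct_mulVec, dotProduct_comm]

lemma PosDef3.smul {A : Matrix (Fin 3) (Fin 3) ℚ} (h : PosDef3 A) {a : ℚ} (ha : 0 < a) :
    PosDef3 (a • A) := by
  refine ⟨h.1.smul a, fun x hx => ?_⟩
  rw [Matrix.smul_mulVec, dotProduct_smul, smul_eq_mul]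
  exact mul_pos ha (h.2 x hx)

/-- The ternary quadratic form `xy + ez²`. -/
def conicForm {R : Type*} [CommRing R] (e : R) (u : Fin 3 → R) : R :=
  u 0 * u 1 + e * u 2 ^ 2

lemma conicForm_smul {R : Type*} [CommRing R] (e a : R) (u : Fin 3 → R) :
    conicForm e (a • u) = a ^ 2 * conicForm e u := by
  simp only [conicForm, Pi.smul_apply, smul_eq_mul]
  ring

/-- A totally singular subspace of a nondegenerate conic has dimension at most one. -/
lemma exists_eq_smul_of_conicForm_eq_zero {F : Type*} [Field F] {e : F} (he : e ≠ 0)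
    {u w : Fin 3 → F} (hu0 : u ≠ 0) (hu : conicForm e u = 0) (hw : conicForm e w = 0)
    (huw : conicForm e (u + w) = 0) : ∃ c : F, w = c • u := by
  simp only [conicForm, Pi.add_apply] at hu hw huw
  have hpol : u 0 * w 1 + u 1 * w 0 + 2 * e * u 2 * w 2 = 0 := by linear_combination huw - hu - hw
  by_cases h0 : u 0 = 0
  · have h2 : u 2 = 0 := by simpa [h0, he] using hu
    have h1 : u 1 ≠ 0 := fun h1 => hu0 <| by
      ext i
      fin_cases i <;> assumption
    have hw0 : w 0 = 0 := by simpa [h0, h1, h2] using hpol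
    have hw2 : w 2 = 0 := by simpa [hw0, he] using hw
    refine ⟨w 1 / u 1, ?_⟩
    ext i
    fin_cases i <;> simp [h0, h1, h2, hw0, hw2]
  · have hd : u 0 * w 2 = w 0 * u 2 := by
      have : e * (u 0 * w 2 - w 0 * u 2) ^ 2 = 0 := by
        linear_combination u 0 ^ 2 * hw + w 0 ^ 2 * hu - u 0 * w 0 * hpol
      rw [mul_eq_zero, or_iff_right he, sq_eq_zero_iff, sub_eq_zero] at this
      exact this
    have hb : u 0 * w 1 = w 0 * u 1 := by
      refine mul_left_cancel₀ h0 ?_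
      linear_combination u 0 * hpol - 2 * w 0 * hu - 2 * e * u 2 * hd
    refine ⟨w 0 / u 0, ?_⟩
    ext i
    fin_cases i
    · simp [h0]
    · simp only [Fin.mk_one, Pi.smul_apply, smul_eq_mul]
      field_simp
      linear_combination hb
    · simp only [Fin.reduceFinMk, Pi.smul_apply, smul_eq_mul]
      field_simp
      linear_combination hd

/-- Representatives of the rational points of the conic `xy + ez² = 0`. -/
def conicPoint {F : Type*} [Field F] (e : F) : Option F → Fin 3 → F
  | none => ![0, 1, 0]
  | some c => ![1, -e * c ^ 2, c]

lemma conicForm_conicPoint {F : Type*} [Field F] (e : F) (t : Option F) :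
    conicForm e (conicPoint e t) = 0 := by
  cases t <;> simp [conicForm, conicPoint]

lemma conicPoint_ne_zero {F : Type*} [Field F] (e : F) (t : Option F) : conicPoint e t ≠ 0 := by
  intro h
  cases t with
  | none => simpa [conicPoint] using congrFun h 1
  | some c => simpa [conicPoint] using congrFun h 0

lemma exists_eq_smul_conicPoint {F : Type*} [Field F] {e : F} (he : e ≠ 0) {u : Fin 3 → F}
    (hu0 : u ≠ 0) (hu : conicForm e u = 0) : ∃ t, ∃ a : F, a ≠ 0 ∧ u = a • conicPoint e t := by
  simp only [conicForm] at hu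
  by_cases h0 : u 0 = 0
  · have h2 : u 2 = 0 := by simpa [h0, he] using hu
    have h1 : u 1 ≠ 0 := fun h1 => hu0 <| by
      ext i
      fin_cases i <;> assumption
    refine ⟨none, u 1, h1, ?_⟩
    ext i
    fin_cases i <;> simp [conicPoint, h0, h2]
  · refine ⟨some (u 2 / u 0), u 0, h0, ?_⟩
    ext i
    fin_cases i
    · simp [conicPoint]
    · simp only [Fin.mk_one, Pi.smul_apply, smul_eq_mul, conicPoint, Matrix.cons_val_one,
        Matrix.cons_val_zero]
      field_simp
      linear_combination hu
    · change u 2 = u 0 * (u 2 / u 0)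
      field_simp

lemma conicPoint_injective_of_smul {F : Type*} [Field F] {e : F} {s t : Option F} {a : F}
    (h : conicPoint e s = a • conicPoint e t) : s = t := by
  have h0 := congrFun h 0
  have h1 := congrFun h 1
  have h2 := congrFun h 2
  simp only [Pi.smul_apply, smul_eq_mul] at h0 h1 h2
  cases s <;> cases t <;> simp only [conicPoint, Matrix.cons_val, mul_zero, mul_one] at h0 h1 h2
  · rfl
  · rw [← h0] at h1
    simp at h1
  · simp at h0
  · rw [h2, ← h0, one_mul]

/-- `T` modulo `p` becomes `xy + ez²` after the base change `M`. -/
def ReducesToConic (p : ℕ) [Fact p.Prime] (T : Matrix (Fin 3) (Fin 3) ℚ) (e : ZMod p)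
    (M : Matrix (Fin 3) (Fin 3) (ZMod p)) : Prop :=
  e ≠ 0 ∧ IsUnit M.det ∧ ∀ (v : Fin 3 → ℤ) (n : ℤ), qf T v = n →
    (n : ZMod p) = conicForm e (M.mulVec fun i => (v i : ZMod p))

lemma dotProduct_Hblock_mulVec (q : ℕ) [Fact q.Prime] (c : ℚ_[q]) (u : Fin 3 → ℚ_[q]) :
    u ⬝ᵥ (Hblock q c).mulVec u = conicForm c u := by
  simp [Hblock, conicForm, Matrix.mulVec, dotProduct, Fin.sum_univ_three]
  ring

/-- The scalar extension of a rational matrix to the `q`-adic numbers. -/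
def padicMat (q : ℕ) [Fact q.Prime] (A : Matrix (Fin 3) (Fin 3) ℚ) :
    Matrix (Fin 3) (Fin 3) ℚ_[q] :=
  A.map fun a => (a : ℚ_[q])

lemma padicMat_mul (q : ℕ) [Fact q.Prime] (A B : Matrix (Fin 3) (Fin 3) ℚ) :
    padicMat q (A * B) = padicMat q A * padicMat q B :=
  map_mul (Rat.castHom ℚ_[q]).mapMatrix A B

lemma padicMat_transpose (q : ℕ) [Fact q.Prime] (A : Matrix (Fin 3) (Fin 3) ℚ) :
    padicMat q Aᵀ = (padicMat q A)ᵀ := rfl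

lemma padicMat_smul (q : ℕ) [Fact q.Prime] (a : ℚ) (A : Matrix (Fin 3) (Fin 3) ℚ) :
    padicMat q (a • A) = (a : ℚ_[q]) • padicMat q A := by
  ext i j
  simp [padicMat]

lemma det_padicMat (q : ℕ) [Fact q.Prime] (A : Matrix (Fin 3) (Fin 3) ℚ) :
    (padicMat q A).det = (A.det : ℚ_[q]) :=
  ((Rat.castHom ℚ_[q]).map_det A).symm

/-- The coefficientwise inclusion of `q`-adic integral matrices into `q`-adic matrices. -/
def coeMat (q : ℕ) [Fact q.Prime] (X : Matrix (Fin 3) (Fin 3) ℤ_[q]) :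
    Matrix (Fin 3) (Fin 3) ℚ_[q] :=
  X.map fun a => (a : ℚ_[q])

lemma coeMat_mul (q : ℕ) [Fact q.Prime] (X Y : Matrix (Fin 3) (Fin 3) ℤ_[q]) :
    coeMat q (X * Y) = coeMat q X * coeMat q Y :=
  map_mul (PadicInt.Coe.ringHom (p := q)).mapMatrix X Y

lemma det_coeMat (q : ℕ) [Fact q.Prime] (X : Matrix (Fin 3) (Fin 3) ℤ_[q]) :
    (coeMat q X).det = (X.det : ℚ_[q]) :=
  ((PadicInt.Coe.ringHom (p := q)).map_det X).symm

/-- An integral matrix viewed over the `q`-adic integers. -/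
def intMat (q : ℕ) [Fact q.Prime] (X : Matrix (Fin 3) (Fin 3) ℤ) :
    Matrix (Fin 3) (Fin 3) ℤ_[q] :=
  X.map fun a => (a : ℤ_[q])

lemma coeMat_intMat (q : ℕ) [Fact q.Prime] (X : Matrix (Fin 3) (Fin 3) ℤ) :
    coeMat q (intMat q X) = padicMat q (intMap X) := by
  ext i j
  simp [coeMat, intMat, padicMat, intMap]

lemma det_intMat (q : ℕ) [Fact q.Prime] (X : Matrix (Fin 3) (Fin 3) ℤ) :
    (intMat q X).det = X.det :=
  ((Int.castRingHom ℤ_[q]).map_det X).symm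

lemma zpEquivTo_iff {q : ℕ} [Fact q.Prime] {A : Matrix (Fin 3) (Fin 3) ℚ}
    {B : Matrix (Fin 3) (Fin 3) ℚ_[q]} : ZpEquivTo q A B ↔
      ∃ X, IsUnit X.det ∧ (coeMat q X)ᵀ * padicMat q A * coeMat q X = B := Iff.rfl

lemma zqEquiv_iff {q : ℕ} [Fact q.Prime] {A B : Matrix (Fin 3) (Fin 3) ℚ} :
    ZqEquiv q A B ↔ ZpEquivTo q A (padicMat q B) := Iff.rfl

lemma intCast_eq_conicForm {p : ℕ} [Fact p.Prime] {ε : ℤ_[p]} {T : Matrix (Fin 3) (Fin 3) ℚ}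
    {P : Matrix (Fin 3) (Fin 3) ℤ_[p]}
    (hP : (coeMat p P)ᵀ * padicMat p T * coeMat p P = Hblock p (ε : ℚ_[p]))
    {v : Fin 3 → ℤ} {u : Fin 3 → ℤ_[p]} (hu : P.mulVec u = fun i => (v i : ℤ_[p]))
    {n : ℤ} (hn : qf T v = n) : (n : ℤ_[p]) = conicForm ε u := by
  let c : ℤ_[p] →+* ℚ_[p] := PadicInt.Coe.ringHom
  have hu' : (coeMat p P).mulVec (c ∘ u) = fun i => (v i : ℚ_[p]) := by
    ext i
    have := congrArg c (congrFun hu i)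
    rw [RingHom.map_mulVec] at this
    rw [map_intCast] at this
    exact this
  refine PadicInt.ext ?_
  have h1 : ((n : ℤ_[p]) : ℚ_[p]) = ((qf T v : ℚ) : ℚ_[p]) := by rw [hn]; simp
  have h2 : ((qf T v : ℚ) : ℚ_[p]) =
      (fun i => (v i : ℚ_[p])) ⬝ᵥ (padicMat p T).mulVec fun i => (v i : ℚ_[p]) := by
    simp [qf, padicMat, Matrix.mulVec, dotProduct]
  have h3 : ((conicForm ε u : ℤ_[p]) : ℚ_[p]) = conicForm (ε : ℚ_[p]) (c ∘ u) := by
    simp [conicForm, c]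
    rfl
  rw [h1, h2, h3, ← dotProduct_Hblock_mulVec, ← hP, ← hu', ← Matrix.mulVec_mulVec,
    ← Matrix.mulVec_mulVec, Matrix.mulVec_transpose, dotProduct_comm (c ∘ u),
    ← Matrix.dotProduct_mulVec, dotProduct_comm]

lemma exists_reducesToConic {p : ℕ} [Fact p.Prime] {ε : ℤ_[p]ˣ} {T : Matrix (Fin 3) (Fin 3) ℚ}
    (hT : ZpEquivTo p T (Hblock p ((ε : ℤ_[p]) : ℚ_[p]))) : ∃ e M, ReducesToConic p T e M := by
  obtain ⟨P, hP, hPT⟩ := zpEquivTo_iff.mp hT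
  refine ⟨PadicInt.toZMod (ε : ℤ_[p]), (P⁻¹).map PadicInt.toZMod, ?_, ?_, ?_⟩
  · exact (ε.isUnit.map PadicInt.toZMod).ne_zero
  · have : ((P⁻¹).map PadicInt.toZMod).det = PadicInt.toZMod (P⁻¹).det :=
      (RingHom.map_det PadicInt.toZMod _).symm
    rw [this]
    exact ((Matrix.isUnit_nonsing_inv_det_iff).mpr hP).map _
  · intro v n hn
    have hPu : P.mulVec ((P⁻¹).mulVec fun i => (v i : ℤ_[p])) = fun i => (v i : ℤ_[p]) := by
      rw [Matrix.mulVec_mulVec, Matrix.mul_nonsing_inv _ hP, Matrix.one_mulVec]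
    have hz := congrArg PadicInt.toZMod (intCast_eq_conicForm hPT hPu hn)
    have hv : PadicInt.toZMod ∘ (fun i => (v i : ℤ_[p])) = fun i => (v i : ZMod p) := by
      ext j
      simp
    rw [map_intCast] at hz
    simp only [hz, conicForm, map_add, map_mul, map_pow, RingHom.map_mulVec, hv]

lemma ZpEquivTo.norm_det_eq {q : ℕ} [Fact q.Prime] {A : Matrix (Fin 3) (Fin 3) ℚ}
    {B : Matrix (Fin 3) (Fin 3) ℚ_[q]} (h : ZpEquivTo q A B) : ‖(A.det : ℚ_[q])‖ = ‖B.det‖ := by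
  obtain ⟨X, hX, rfl⟩ := zpEquivTo_iff.mp h
  have : ‖(X.det : ℚ_[q])‖ = 1 := by
    rw [← PadicInt.norm_def]
    exact PadicInt.isUnit_iff.mp hX
  simp [Matrix.det_mul, det_coeMat, det_padicMat, this]

lemma ZqEquiv.norm_det_eq {q : ℕ} [Fact q.Prime] {A B : Matrix (Fin 3) (Fin 3) ℚ}
    (h : ZqEquiv q A B) : ‖(A.det : ℚ_[q])‖ = ‖(B.det : ℚ_[q])‖ := by
  rw [(zqEquiv_iff.mp h).norm_det_eq, det_padicMat]

lemma ZqEquiv.trans_zpEquivTo {q : ℕ} [Fact q.Prime] {A B : Matrix (Fin 3) (Fin 3) ℚ}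
    {C : Matrix (Fin 3) (Fin 3) ℚ_[q]} (h : ZqEquiv q A B) (h' : ZpEquivTo q B C) :
    ZpEquivTo q A C := by
  obtain ⟨X, hX, hXB⟩ := zpEquivTo_iff.mp (zqEquiv_iff.mp h)
  obtain ⟨Y, hY, rfl⟩ := zpEquivTo_iff.mp h'
  refine zpEquivTo_iff.mpr ⟨X * Y, by rw [Matrix.det_mul]; exact hX.mul hY, ?_⟩
  rw [← hXB, coeMat_mul, Matrix.transpose_mul]
  simp only [Matrix.mul_assoc]

lemma ZqEquiv.smul {q : ℕ} [Fact q.Prime] {A B : Matrix (Fin 3) (Fin 3) ℚ} (h : ZqEquiv q A B)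
    (a : ℚ) : ZqEquiv q (a • A) (a • B) := by
  obtain ⟨X, hX, hXB⟩ := zpEquivTo_iff.mp (zqEquiv_iff.mp h)
  refine ⟨X, hX, ?_⟩
  change (coeMat q X)ᵀ * padicMat q (a • A) * coeMat q X = padicMat q (a • B)
  rw [padicMat_smul, padicMat_smul, ← hXB]
  simp

lemma det_Hblock (q : ℕ) [Fact q.Prime] (c : ℚ_[q]) : (Hblock q c).det = -(c / 4) := by
  rw [Hblock, Matrix.det_fin_three]
  simp
  ring

lemma Int.natAbs_eq_of_padic_norm_eq {a b : ℤ} (ha : a ≠ 0) (hb : b ≠ 0)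
    (h : ∀ q : ℕ, ∀ hq : q.Prime, haveI := Fact.mk hq; ‖(a : ℚ_[q])‖ = ‖(b : ℚ_[q])‖) :
    a.natAbs = b.natAbs := by
  refine Nat.eq_of_factorization_eq (Int.natAbs_ne_zero.mpr ha) (Int.natAbs_ne_zero.mpr hb)
    fun q => ?_
  by_cases hq : q.Prime
  · have := Fact.mk hq
    have h1 := h q hq
    rw [Padic.norm_eq_zpow_neg_valuation (by exact_mod_cast ha),
      Padic.norm_eq_zpow_neg_valuation (by exact_mod_cast hb), Padic.valuation_intCast,
      Padic.valuation_intCast] at h1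
    have h2 := zpow_right_injective₀ (by exact_mod_cast hq.pos) (by exact_mod_cast hq.one_lt.ne') h1
    rw [Nat.factorization_def _ hq, Nat.factorization_def _ hq]
    simp only [neg_inj, Nat.cast_inj] at h2
    exact h2
  · simp [Nat.factorization_eq_zero_of_not_prime, hq]

/-- An isometry of `H ⊕ [ε]` moving a given isotropic line modulo `p` to the line of the first
basis vector. -/
lemma exists_isometry_Hblock {p : ℕ} [Fact p.Prime] (ε : ℤ_[p]ˣ) {u : Fin 3 → ℤ_[p]}
    (hu0 : ∃ i, ¬ (p : ℤ_[p]) ∣ u i) (hu : (p : ℤ_[p]) ∣ conicForm (ε : ℤ_[p]) u) :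
    ∃ U : Matrix (Fin 3) (Fin 3) ℤ_[p], IsUnit U.det ∧
      (coeMat p U)ᵀ * Hblock p ((ε : ℤ_[p]) : ℚ_[p]) * coeMat p U
        = Hblock p ((ε : ℤ_[p]) : ℚ_[p]) ∧
      ∃ (a : ℤ_[p]) (w : Fin 3 → ℤ_[p]), ∀ i, U i 0 = a * u i + p * w i := by
  have hunit (x : ℤ_[p]) (hx : ¬ (p : ℤ_[p]) ∣ x) : ∃ a, a * x = 1 := by
    have : IsUnit x := by
      rw [PadicInt.isUnit_iff]
      rw [← PadicInt.norm_lt_one_iff_dvd] at hx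
      exact le_antisymm (PadicInt.norm_le_one x) (not_lt.mp hx)
    exact this.exists_left_inv
  obtain ⟨r, hr⟩ := hu
  rw [conicForm] at hr
  by_cases h0 : (p : ℤ_[p]) ∣ u 0
  · have h1 : ¬ (p : ℤ_[p]) ∣ u 1 := fun h1 => by
      have h2 : (p : ℤ_[p]) ∣ u 2 := by
        have : (p : ℤ_[p]) ∣ ε * u 2 ^ 2 := by
          have := (Dvd.intro r hr.symm).sub (h0.mul_right (u 1))
          simpa using this
        rw [ε.isUnit.dvd_mul_left] at this
        exact PadicInt.prime_p.dvd_of_dvd_pow this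
      obtain ⟨i, hi⟩ := hu0
      fin_cases i <;> contradiction
    obtain ⟨a, ha⟩ := hunit _ h1
    let s := a * u 2
    refine ⟨!![-ε * s ^ 2, 1, -(ε * s + ε * s); 1, 0, 0; s, 0, 1], ?_, ?_, a, ![-(a ^ 2 * r), 0, 0], ?_⟩
    · rw [Matrix.det_fin_three]
      simp
    · ext i j
      fin_cases i <;> fin_cases j <;>
        simp [coeMat, Hblock, Matrix.mul_apply, Fin.sum_univ_three] <;> ring
    · intro i
      fin_cases i
      · simp [s]
        linear_combination (-a^2) * hr + a * u 0 * ha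
      · simp [ha]
      · simp [s]
  · obtain ⟨a, ha⟩ := hunit _ h0
    let s := a * u 2
    refine ⟨!![1, 0, 0; -ε * s ^ 2, 1, -(ε * s + ε * s); s, 0, 1], ?_, ?_, a, ![0, -(a ^ 2 * r), 0], ?_⟩
    · rw [Matrix.det_fin_three]
      simp
    · ext i j
      fin_cases i <;> fin_cases j <;>
        simp [coeMat, Hblock, Matrix.mul_apply, Fin.sum_univ_three] <;> ring
    · intro i
      fin_cases i
      · simp [ha]
      · simp [s]
        linear_combination (-a^2) * hr + a * u 1 * ha
      · simp [s]

/-- The reduction of an integral matrix modulo `p`. -/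
def redMat (p : ℕ) (X : Matrix (Fin 3) (Fin 3) ℤ) : Matrix (Fin 3) (Fin 3) (ZMod p) :=
  X.map fun a => (a : ZMod p)

lemma redMat_mul (p : ℕ) (X Y : Matrix (Fin 3) (Fin 3) ℤ) :
    redMat p (X * Y) = redMat p X * redMat p Y :=
  map_mul (Int.castRingHom (ZMod p)).mapMatrix X Y

lemma det_redMat (p : ℕ) (X : Matrix (Fin 3) (Fin 3) ℤ) : (redMat p X).det = X.det :=
  ((Int.castRingHom (ZMod p)).map_det X).symm

lemma redMat_mulVec (p : ℕ) (X : Matrix (Fin 3) (Fin 3) ℤ) (v : Fin 3 → ℤ) :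
    (redMat p X).mulVec (fun i => (v i : ZMod p)) = fun i => ((X.mulVec v) i : ZMod p) := by
  ext i
  simp [redMat, Matrix.mulVec, dotProduct]

lemma redMat_eq_zero_iff {p : ℕ} {X : Matrix (Fin 3) (Fin 3) ℤ} :
    redMat p X = 0 ↔ ∃ Z : Matrix (Fin 3) (Fin 3) ℤ, X = (p : ℤ) • Z := by
  constructor
  · intro h
    have (i j : Fin 3) : (p : ℤ) ∣ X i j :=
      (ZMod.intCast_zmod_eq_zero_iff_dvd _ _).mp (congrFun (congrFun h i) j)
    choose Z hZ using this
    exact ⟨Z, by ext i j; exact hZ i j⟩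
  · rintro ⟨Z, rfl⟩
    ext i j
    change (((p : ℤ) * Z i j : ℤ) : ZMod p) = 0
    simp

lemma exists_lift (p : ℕ) (v : Fin 3 → ZMod p) :
    ∃ w : Fin 3 → ℤ, (fun i => (w i : ZMod p)) = v := by
  choose w hw using fun i => ZMod.intCast_surjective (v i)
  exact ⟨w, funext hw⟩

/-- Over a form represented with index `p`, kernel vectors modulo `p` are isotropic modulo `p`. -/
lemma exists_qf_eq_mul_of_redMat_mulVec_eq_zero {p : ℕ} {A T : Matrix (Fin 3) (Fin 3) ℚ}
    (hp : p ≠ 0) (hs : A.IsSymm) (hA : HalfIntegral A) {Y : Matrix (Fin 3) (Fin 3) ℤ}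
    (hY : (intMap Y)ᵀ * A * intMap Y = (p : ℚ) • T) {v : Fin 3 → ℤ}
    (hv : (redMat p Y).mulVec (fun i => (v i : ZMod p)) = 0) :
    ∃ n : ℤ, qf T v = ((p * n : ℤ) : ℚ) := by
  rw [redMat_mulVec] at hv
  have (i : Fin 3) : (p : ℤ) ∣ Y.mulVec v i :=
    (ZMod.intCast_zmod_eq_zero_iff_dvd _ _).mp (congrFun hv i)
  choose w hw using this
  have hw : Y.mulVec v = (p : ℤ) • w := funext hw
  obtain ⟨n, hn⟩ := hA.exists_qf_eq hs w
  refine ⟨n, ?_⟩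
  have h1 := qf_mulVec A Y v
  rw [hw, hY, qf_smul_vec, qf_smul, hn] at h1
  have hp' : (p : ℚ) ≠ 0 := by exact_mod_cast hp
  apply mul_left_cancel₀ hp'
  rw [← h1]
  push_cast
  ring

lemma zpEquivTo_Hblock_of_index_p {p : ℕ} [Fact p.Prime] {ε : ℤ_[p]ˣ}
    {A T : Matrix (Fin 3) (Fin 3) ℚ} (hs : A.IsSymm) (hA : HalfIntegral A)
    {Y : Matrix (Fin 3) (Fin 3) ℤ} (hdet : Y.det.natAbs = p)
    (hY : (intMap Y)ᵀ * A * intMap Y = (p : ℚ) • T)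
    (hT : ZpEquivTo p T (Hblock p ((ε : ℤ_[p]) : ℚ_[p]))) :
    ZpEquivTo p A (Hblock p ((p : ℚ_[p]) * ((ε : ℤ_[p]) : ℚ_[p]))) := by
  have hp0 : p ≠ 0 := (Fact.out : p.Prime).ne_zero
  have hpz : (p : ℤ_[p]) ≠ 0 := by exact_mod_cast hp0
  have hdetunit : ∃ s : ℤ_[p], IsUnit s ∧ (Y.det : ℤ_[p]) = p * s := by
    rcases Int.natAbs_eq Y.det with h | h <;> rw [hdet] at h <;> rw [h]
    · exact ⟨1, isUnit_one, by simp⟩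
    · exact ⟨-1, isUnit_one.neg, by simp⟩
  obtain ⟨P, hP, hPT⟩ := zpEquivTo_iff.mp hT
  obtain ⟨v', hv'0, hv'⟩ := Matrix.exists_mulVec_eq_zero_iff.mpr
    (show (redMat p Y).det = 0 by
      rw [det_redMat, ZMod.intCast_zmod_eq_zero_iff_dvd, Int.natCast_dvd, hdet])
  obtain ⟨v, rfl⟩ := exists_lift p v'
  obtain ⟨n, hn⟩ := exists_qf_eq_mul_of_redMat_mulVec_eq_zero hp0 hs hA hY hv'
  let u : Fin 3 → ℤ_[p] := (P⁻¹).mulVec fun i => (v i : ℤ_[p])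
  have hPu : P.mulVec u = fun i => (v i : ℤ_[p]) := by
    rw [Matrix.mulVec_mulVec, Matrix.mul_nonsing_inv _ hP, Matrix.one_mulVec]
  have hconic := intCast_eq_conicForm hPT hPu hn
  have hu0 : ∃ i, ¬ (p : ℤ_[p]) ∣ u i := by
    by_contra! hall
    refine hv'0 (funext fun i => ?_)
    have h1 : (p : ℤ_[p]) ∣ (v i : ℤ_[p]) := by
      rw [← congrFun hPu i, Matrix.mulVec, dotProduct]
      exact Finset.dvd_sum fun j _ => (hall j).mul_left _
    obtain ⟨c, hc⟩ := h1
    have := congrArg PadicInt.toZMod hc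
    simpa using this
  obtain ⟨U, hU, hUH, a, w, hUw⟩ := exists_isometry_Hblock ε hu0
    (Dvd.intro (n : ℤ_[p]) (by rw [← hconic]; push_cast; rfl))
  let M₀ := intMat p Y * P * U
  have hcol (i : Fin 3) : (p : ℤ_[p]) ∣ M₀ i 0 := by
    have hU0 : U.col 0 = a • u + (p : ℤ_[p]) • w := funext hUw
    have h1 : M₀ i 0 = (intMat p Y * P).mulVec (U.col 0) i := by
      simp [M₀, Matrix.mul_apply, Matrix.mulVec, dotProduct]
    have h2 : (p : ℤ_[p]) ∣ (intMat p Y).mulVec (fun i => (v i : ℤ_[p])) i := by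
      have h3 : (intMat p Y).mulVec (fun i => (v i : ℤ_[p])) i = ((Y.mulVec v i : ℤ) : ℤ_[p]) := by
        simp [intMat, Matrix.mulVec, dotProduct]
      rw [h3]
      rw [redMat_mulVec] at hv'
      obtain ⟨c, hc⟩ := (ZMod.intCast_zmod_eq_zero_iff_dvd _ _).mp (congrFun hv' i)
      exact ⟨c, by rw [hc]; push_cast; rfl⟩
    rw [h1, hU0, Matrix.mulVec_add, Matrix.mulVec_smul, Matrix.mulVec_smul, ← Matrix.mulVec_mulVec,
      hPu]
    exact dvd_add (h2.mul_left a) (Dvd.intro _ rfl)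
  choose x hx using hcol
  let X := M₀.updateCol 0 x
  let D : Matrix (Fin 3) (Fin 3) ℤ_[p] := Matrix.diagonal ![(p : ℤ_[p]), 1, 1]
  have hXD : X * D = M₀ := by
    ext i j
    rw [Matrix.mul_diagonal]
    fin_cases j
    · simp [X, hx, mul_comm]
    · simp [X]
    · simp [X]
  have hDdet : D.det = p := by simp [D, Matrix.det_diagonal, Fin.prod_univ_three]
  refine zpEquivTo_iff.mpr ⟨X, ?_, ?_⟩
  · obtain ⟨s, hs, hYs⟩ := hdetunit
    have h1 : X.det * p = p * s * P.det * U.det := by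
      rw [← hDdet, ← Matrix.det_mul, hXD, Matrix.det_mul, Matrix.det_mul, det_intMat, hYs, hDdet]
    have h2 : X.det = s * P.det * U.det := mul_left_cancel₀ hpz (by linear_combination h1)
    rw [h2]
    exact (hs.mul hP).mul hU
  · have hD : IsUnit (coeMat p D).det := by
      rw [det_coeMat, hDdet, isUnit_iff_ne_zero]
      simpa using hp0
    have hM : (coeMat p M₀)ᵀ * padicMat p A * coeMat p M₀ =
        (p : ℚ_[p]) • Hblock p ((ε : ℤ_[p]) : ℚ_[p]) := by
      have hY' : (padicMat p (intMap Y))ᵀ * padicMat p A * padicMat p (intMap Y) =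
          (p : ℚ_[p]) • padicMat p T := by
        rw [← padicMat_transpose, ← padicMat_mul, ← padicMat_mul, hY, padicMat_smul]
        simp
      calc _ = (coeMat p U)ᵀ * ((coeMat p P)ᵀ * ((padicMat p (intMap Y))ᵀ * padicMat p A *
            padicMat p (intMap Y)) * coeMat p P) * coeMat p U := by
            simp only [M₀, coeMat_mul, Matrix.transpose_mul, coeMat_intMat, Matrix.mul_assoc]
        _ = _ := by
            rw [hY', Matrix.mul_smul, Matrix.smul_mul, hPT, Matrix.mul_smul, Matrix.smul_mul, hUH]
    have hH : (coeMat p D)ᵀ * Hblock p ((p : ℚ_[p]) * ((ε : ℤ_[p]) : ℚ_[p])) * coeMat p D =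
        (p : ℚ_[p]) • Hblock p ((ε : ℤ_[p]) : ℚ_[p]) := by
      ext i j
      fin_cases i <;> fin_cases j <;>
        simp [coeMat, Hblock, D, Matrix.mul_apply, Fin.sum_univ_three, Matrix.diagonal, mul_comm]
    rw [← hXD, coeMat_mul, Matrix.transpose_mul, ← hH] at hM
    have hD' : IsUnit (coeMat p D)ᵀ.det := by rwa [Matrix.det_transpose]
    have hc := congrArg (fun Z => ((coeMat p D)ᵀ)⁻¹ * Z * (coeMat p D)⁻¹) hM
    simp only [Matrix.mul_assoc] at hc
    rw [Matrix.mul_nonsing_inv _ hD] at hc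
    simp only [Matrix.nonsing_inv_mul_cancel_left _ _ hD', Matrix.mul_one] at hc
    rw [Matrix.mul_assoc]
    exact hc

lemma zqEquiv_of_index_p {p q : ℕ} (hp : p.Prime) [Fact q.Prime] (hqp : q ≠ p)
    {A T : Matrix (Fin 3) (Fin 3) ℚ} {Y : Matrix (Fin 3) (Fin 3) ℤ} (hdet : Y.det.natAbs = p)
    (hY : (intMap Y)ᵀ * A * intMap Y = (p : ℚ) • T) : ZqEquiv q A ((p : ℚ) • T) := by
  refine zqEquiv_iff.mpr (zpEquivTo_iff.mpr ⟨intMat q Y, ?_, ?_⟩)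
  · rw [det_intMat, PadicInt.isUnit_iff, PadicInt.norm_intCast_eq_one_iff,
      Int.isCoprime_iff_gcd_eq_one, Int.gcd, hdet, Int.natAbs_natCast]
    exact (Nat.coprime_primes hp Fact.out).mpr hqp.symm
  · rw [coeMat_intMat, ← padicMat_transpose, ← padicMat_mul, ← padicMat_mul, hY]

/-- Every line modulo `p` is the kernel of an integral matrix of determinant `p`. -/
lemma exists_det_eq_and_ker {p : ℕ} [Fact p.Prime] {v : Fin 3 → ZMod p} (hv : v ≠ 0) :
    ∃ Y : Matrix (Fin 3) (Fin 3) ℤ, Y.det = p ∧ (redMat p Y).mulVec v = 0 ∧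
      ∀ z, (redMat p Y).mulVec z = 0 → ∃ c : ZMod p, z = c • v := by
  obtain ⟨i, hi⟩ := Function.ne_iff.mp hv
  obtain ⟨w, hw⟩ := exists_lift p ((v i)⁻¹ • v)
  have hw (j : Fin 3) : (w j : ZMod p) * v i = v j := by
    have := congrFun hw j
    simp only [Pi.smul_apply, smul_eq_mul] at this
    rw [this, mul_comm, mul_inv_cancel_left₀ hi]
  have finish (Y : Matrix (Fin 3) (Fin 3) ℤ) (hdet : Y.det = p)
      (hY : ∀ z j, (redMat p Y).mulVec z j = if j = i then 0 else z j - w j * z i) :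
      ∃ Y : Matrix (Fin 3) (Fin 3) ℤ, Y.det = p ∧ (redMat p Y).mulVec v = 0 ∧
        ∀ z, (redMat p Y).mulVec z = 0 → ∃ c : ZMod p, z = c • v := by
    refine ⟨Y, hdet, ?_, fun z hz => ⟨z i / v i, ?_⟩⟩
    · ext j
      rw [hY, hw]
      simp
    · ext j
      have h1 := hY z j
      rw [hz] at h1
      simp only [Pi.smul_apply, smul_eq_mul]
      have hi' : v i ≠ 0 := hi
      by_cases hj : j = i
      · rw [hj, div_mul_cancel₀ _ hi']
      · rw [if_neg hj, Pi.zero_apply, eq_comm, sub_eq_zero] at h1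
        rw [h1, ← hw j]
        field_simp
  fin_cases i
  · refine finish !![(p : ℤ), 0, 0; -w 1, 1, 0; -w 2, 0, 1] (by simp [Matrix.det_fin_three]) ?_
    intro z j
    fin_cases j <;> simp [redMat, Matrix.mulVec, dotProduct, Fin.sum_univ_three] <;> ring
  · refine finish !![1, -w 0, 0; 0, (p : ℤ), 0; 0, -w 2, 1] (by simp [Matrix.det_fin_three]) ?_
    intro z j
    fin_cases j <;> simp [redMat, Matrix.mulVec, dotProduct, Fin.sum_univ_three] <;> ring
  · refine finish !![1, 0, -w 0; 0, 1, -w 1; 0, 0, (p : ℤ)] (by simp [Matrix.det_fin_three]) ?_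
    intro z j
    fin_cases j <;> simp [redMat, Matrix.mulVec, dotProduct, Fin.sum_univ_three] <;> ring

/-- Integral matrices of determinant `± p` with the same kernel modulo `p` differ by a
unimodular left factor. -/
lemma exists_eq_mul_of_ker {p : ℕ} [Fact p.Prime] {Y Y₀ : Matrix (Fin 3) (Fin 3) ℤ}
    (hY : Y.det.natAbs = p) (hY₀ : Y₀.det.natAbs = p) {v : Fin 3 → ZMod p}
    (hv : (redMat p Y).mulVec v = 0)
    (hker : ∀ z, (redMat p Y₀).mulVec z = 0 → ∃ c : ZMod p, z = c • v) :
    ∃ g : Matrix (Fin 3) (Fin 3) ℤ, IsUnit g.det ∧ Y = g * Y₀ := by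
  have hp0 : p ≠ 0 := (Fact.out : p.Prime).ne_zero
  have hdet0 : Y₀.det = p ∨ Y₀.det = -p := by
    rw [← hY₀]
    exact Int.natAbs_eq _
  have hadj0 : redMat p Y₀ * redMat p Y₀.adjugate = 0 := by
    rw [← redMat_mul, Matrix.mul_adjugate, redMat_eq_zero_iff]
    rcases hdet0 with h | h
    · exact ⟨1, by rw [h]⟩
    · exact ⟨-1, by rw [h]; simp⟩
  have hadj : redMat p (Y * Y₀.adjugate) = 0 := by
    rw [redMat_mul]
    ext i j
    have hj : (redMat p Y₀).mulVec ((redMat p Y₀.adjugate).col j) = 0 := by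
      ext i
      exact congrFun (congrFun hadj0 i) j
    obtain ⟨c, hc⟩ := hker _ hj
    have : (redMat p Y).mulVec ((redMat p Y₀.adjugate).col j) = 0 := by
      rw [hc, Matrix.mulVec_smul, hv, smul_zero]
    exact congrFun this i
  obtain ⟨G, hG⟩ := redMat_eq_zero_iff.mp hadj
  have h1 : Y₀.det • Y = (p : ℤ) • (G * Y₀) := by
    rw [← Matrix.smul_mul, ← hG, Matrix.mul_assoc, Matrix.adjugate_mul, Matrix.mul_smul,
      Matrix.mul_one]
  have hpz : (p : ℤ) ≠ 0 := by exact_mod_cast hp0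
  obtain ⟨g, hg⟩ : ∃ g : Matrix (Fin 3) (Fin 3) ℤ, Y = g * Y₀ := by
    rcases hdet0 with h | h
    · rw [h] at h1
      exact ⟨G, smul_right_injective _ hpz h1⟩
    · rw [h] at h1
      refine ⟨-G, smul_right_injective _ hpz ?_⟩
      simp only [Matrix.neg_mul, smul_neg, ← h1]
      simp
  refine ⟨g, ?_, hg⟩
  rw [hg, Matrix.det_mul, Int.natAbs_mul, hY₀] at hY
  rw [Int.isUnit_iff_natAbs_eq]
  exact Nat.eq_of_mul_eq_mul_right (Nat.pos_of_ne_zero hp0) (by rw [hY, one_mul])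

lemma ReducesToConic.dvd_iff {p : ℕ} [Fact p.Prime] {T : Matrix (Fin 3) (Fin 3) ℚ} {e : ZMod p}
    {M : Matrix (Fin 3) (Fin 3) (ZMod p)} (h : ReducesToConic p T e M) {v : Fin 3 → ℤ} {n : ℤ}
    (hn : qf T v = n) :
    (p : ℤ) ∣ n ↔ conicForm e (M.mulVec fun i => (v i : ZMod p)) = 0 := by
  rw [← h.2.2 v n hn, ZMod.intCast_zmod_eq_zero_iff_dvd]

lemma ReducesToConic.exists_eq_smul {p : ℕ} [Fact p.Prime] {T : Matrix (Fin 3) (Fin 3) ℚ}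
    {e : ZMod p} {M : Matrix (Fin 3) (Fin 3) (ZMod p)} (h : ReducesToConic p T e M)
    {v w : Fin 3 → ZMod p} (hv0 : v ≠ 0) (hv : conicForm e (M.mulVec v) = 0)
    (hw : conicForm e (M.mulVec w) = 0) (hvw : conicForm e (M.mulVec (v + w)) = 0) :
    ∃ c : ZMod p, w = c • v := by
  have hinj := Matrix.mulVec_injective_of_isUnit ((Matrix.isUnit_iff_isUnit_det _).mpr h.2.1)
  rw [Matrix.mulVec_add] at hvw
  obtain ⟨c, hc⟩ := exists_eq_smul_of_conicForm_eq_zero h.1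
    (fun h0 => hv0 (hinj (by rw [h0, Matrix.mulVec_zero]))) hv hw hvw
  exact ⟨c, hinj (by rw [hc, Matrix.mulVec_smul])⟩

section Kernel

variable {p : ℕ} [Fact p.Prime] {T A : Matrix (Fin 3) (Fin 3) ℚ} {e : ZMod p}
  {M : Matrix (Fin 3) (Fin 3) (ZMod p)} {Y : Matrix (Fin 3) (Fin 3) ℤ}

lemma ReducesToConic.conicForm_eq_zero_of_ker (h : ReducesToConic p T e M) (hs : A.IsSymm)
    (hA : HalfIntegral A) (hY : (intMap Y)ᵀ * A * intMap Y = (p : ℚ) • T)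
    {v : Fin 3 → ZMod p} (hv : (redMat p Y).mulVec v = 0) : conicForm e (M.mulVec v) = 0 := by
  obtain ⟨w, rfl⟩ := exists_lift p v
  obtain ⟨n, hn⟩ := exists_qf_eq_mul_of_redMat_mulVec_eq_zero (Fact.out : p.Prime).ne_zero hs hA hY hv
  exact (h.dvd_iff hn).mp (Dvd.intro _ rfl)

lemma ReducesToConic.ker_le (h : ReducesToConic p T e M) (hs : A.IsSymm)
    (hA : HalfIntegral A) (hY : (intMap Y)ᵀ * A * intMap Y = (p : ℚ) • T)
    {v : Fin 3 → ZMod p} (hv0 : v ≠ 0) (hv : (redMat p Y).mulVec v = 0) {w : Fin 3 → ZMod p}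
    (hw : (redMat p Y).mulVec w = 0) : ∃ c : ZMod p, w = c • v :=
  h.exists_eq_smul hv0 (h.conicForm_eq_zero_of_ker hs hA hY hv)
    (h.conicForm_eq_zero_of_ker hs hA hY hw)
    (h.conicForm_eq_zero_of_ker hs hA hY (by rw [Matrix.mulVec_add, hv, hw, add_zero]))

/-- An isotropic line modulo `p` comes from a half-integral overlattice of index `p`. -/
lemma ReducesToConic.exists_overlattice (h : ReducesToConic p T e M) (hT : PosDef3 T)
    (hTh : HalfIntegral T) {v : Fin 3 → ZMod p} (hv0 : v ≠ 0)
    (hv : conicForm e (M.mulVec v) = 0) :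
    ∃ (A : Matrix (Fin 3) (Fin 3) ℚ) (Y : Matrix (Fin 3) (Fin 3) ℤ), PosDef3 A ∧ HalfIntegral A ∧
      Y.det.natAbs = p ∧ (intMap Y)ᵀ * A * intMap Y = (p : ℚ) • T ∧ (redMat p Y).mulVec v = 0 := by
  obtain ⟨Y, hdet, hYv, hker⟩ := exists_det_eq_and_ker hv0
  have hp0 : (p : ℚ) ≠ 0 := by exact_mod_cast (Fact.out : p.Prime).ne_zero
  have hppos : (0 : ℚ) < p := by exact_mod_cast (Fact.out : p.Prime).pos
  let A := (p : ℚ)⁻¹ • ((intMap Y.adjugate)ᵀ * T * intMap Y.adjugate)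
  have hApos : PosDef3 A := by
    refine (hT.congr ?_).smul (inv_pos.mpr hppos)
    rw [det_intMap, Matrix.det_adjugate, hdet, isUnit_iff_ne_zero]
    simpa using hp0
  refine ⟨A, Y, hApos, halfIntegral_of_qf hApos.1 fun x => ?_, by rw [hdet, Int.natAbs_natCast],
    ?_, hYv⟩
  · obtain ⟨n, hn⟩ := hTh.exists_qf_eq hT.1 (Y.adjugate.mulVec x)
    have hk : (redMat p Y).mulVec (fun i => (Y.adjugate.mulVec x i : ZMod p)) = 0 := by
      rw [redMat_mulVec, Matrix.mulVec_mulVec, Matrix.mul_adjugate, hdet, Matrix.smul_mulVec,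
        Matrix.one_mulVec]
      ext i
      simp
    obtain ⟨c, hc⟩ := hker _ hk
    obtain ⟨m, rfl⟩ := (h.dvd_iff hn).mpr (by
      rw [hc, Matrix.mulVec_smul, conicForm_smul, hv, mul_zero])
    refine ⟨m, ?_⟩
    rw [qf_smul, ← qf_mulVec, hn]
    push_cast
    field_simp
  · have hadj : intMap Y.adjugate * intMap Y = (p : ℚ) • 1 := by
      rw [← intMap_mul, Matrix.adjugate_mul, hdet, intMap_smul, intMap_one, Int.cast_natCast]
    have hadj' : (intMap Y)ᵀ * (intMap Y.adjugate)ᵀ = (p : ℚ) • 1 := by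
      rw [← Matrix.transpose_mul, hadj, Matrix.transpose_smul, Matrix.transpose_one]
    calc (intMap Y)ᵀ * A * intMap Y = (p : ℚ)⁻¹ • (((intMap Y)ᵀ * (intMap Y.adjugate)ᵀ) * T *
          (intMap Y.adjugate * intMap Y)) := by
          simp only [A, Matrix.mul_smul, Matrix.smul_mul, Matrix.mul_assoc]
      _ = (p : ℚ) • T := by
          rw [hadj, hadj']
          simp only [Matrix.smul_mul, Matrix.mul_smul, Matrix.one_mul, Matrix.mul_one, smul_smul]
          rw [inv_mul_cancel_left₀ hp0]

/-- Each isotropic line modulo `p` is the kernel of exactly one representation up to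
automorphs of the representing form. -/
lemma ReducesToConic.sum_card_ker_div_autNum (h : ReducesToConic p T e M) (hT : PosDef3 T)
    (hTh : HalfIntegral T) {k : ℕ} {S : Fin k → Matrix (Fin 3) (Fin 3) ℚ}
    (hS : ∀ j, PosDef3 (S j) ∧ HalfIntegral (S j))
    (hSne : ∀ i j, i ≠ j → ¬ ZEquiv (S i) (S j))
    (hdet : ∀ j Y, (intMap Y)ᵀ * S j * intMap Y = (p : ℚ) • T → Y.det.natAbs = p)
    (hex : ∀ A Y, PosDef3 A → HalfIntegral A → Y.det.natAbs = p →
      (intMap Y)ᵀ * A * intMap Y = (p : ℚ) • T → ∃ j, ZEquiv A (S j))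
    {v : Fin 3 → ZMod p} (hv0 : v ≠ 0) (hv : conicForm e (M.mulVec v) = 0) :
    ∑ j, (Nat.card {Y : {Y : Matrix (Fin 3) (Fin 3) ℤ //
      (intMap Y)ᵀ * S j * intMap Y = (p : ℚ) • T} // (redMat p Y).mulVec v = 0} : ℚ) /
        autNum (S j) = 1 := by
  obtain ⟨A, Y₁, hA, hAh, hdet₁, hY₁, hY₁v⟩ := h.exists_overlattice hT hTh hv0 hv
  obtain ⟨j₀, g₁, hg₁, hg₁A⟩ := hex A Y₁ hA hAh hdet₁ hY₁
  obtain ⟨Y₀, hY₀, hY₀v⟩ : ∃ Y₀, g₁ * Y₀ = Y₁ ∧ (redMat p Y₀).mulVec v = 0 := by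
    refine ⟨g₁⁻¹ * Y₁, Matrix.mul_nonsing_inv_cancel_left _ _ hg₁, ?_⟩
    rw [redMat_mul, ← Matrix.mulVec_mulVec, hY₁v, Matrix.mulVec_zero]
  have hY₀T : (intMap Y₀)ᵀ * S j₀ * intMap Y₀ = (p : ℚ) • T := by
    rw [← hg₁A, ← hY₁, ← hY₀, intMap_mul, Matrix.transpose_mul]
    simp only [Matrix.mul_assoc]
  have hY₀inj : IsUnit (intMap Y₀).det := by
    rw [det_intMap, isUnit_iff_ne_zero]
    intro h0
    have := hdet _ _ hY₀T
    rw [Int.cast_eq_zero.mp h0] at this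
    exact (Fact.out : p.Prime).ne_zero this.symm
  have hfactor (j : Fin k) (Y : Matrix (Fin 3) (Fin 3) ℤ)
      (hY : (intMap Y)ᵀ * S j * intMap Y = (p : ℚ) • T) (hYv : (redMat p Y).mulVec v = 0) :
      ∃ g : Matrix (Fin 3) (Fin 3) ℤ, IsUnit g.det ∧ Y = g * Y₀ ∧
        (intMap g)ᵀ * S j * intMap g = S j₀ := by
    obtain ⟨g, hg, rfl⟩ := exists_eq_mul_of_ker (hdet _ _ hY) (hdet _ _ hY₀T) hYv
      (fun z hz => h.ker_le (hS j₀).1.1 (hS j₀).2 hY₀T hv0 hY₀v hz)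
    refine ⟨g, hg, rfl, ?_⟩
    rw [← hY₀T, intMap_mul, Matrix.transpose_mul] at hY
    have hY₀inj' : IsUnit (intMap Y₀)ᵀ.det := by rwa [Matrix.det_transpose]
    have hc := congrArg (fun Z => ((intMap Y₀)ᵀ)⁻¹ * Z * (intMap Y₀)⁻¹) hY
    simp only [Matrix.mul_assoc, Matrix.mul_nonsing_inv _ hY₀inj,
      Matrix.nonsing_inv_mul_cancel_left _ _ hY₀inj', Matrix.mul_one] at hc
    rw [Matrix.mul_assoc, hc]
  rw [Finset.sum_eq_single j₀]
  · have hcard : Nat.card {Y : {Y : Matrix (Fin 3) (Fin 3) ℤ //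
        (intMap Y)ᵀ * S j₀ * intMap Y = (p : ℚ) • T} // (redMat p Y).mulVec v = 0} =
        autNum (S j₀) := by
      have hrep (g : Matrix (Fin 3) (Fin 3) ℤ) (hg : (intMap g)ᵀ * S j₀ * intMap g = S j₀) :
          (intMap (g * Y₀))ᵀ * S j₀ * intMap (g * Y₀) = (p : ℚ) • T := by
        rw [intMap_mul, Matrix.transpose_mul, ← hY₀T]
        nth_rewrite 2 [← hg]
        simp only [Matrix.mul_assoc]
      have hker (g : Matrix (Fin 3) (Fin 3) ℤ) : (redMat p (g * Y₀)).mulVec v = 0 := by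
        rw [redMat_mul, ← Matrix.mulVec_mulVec, hY₀v, Matrix.mulVec_zero]
      refine (Nat.card_congr (Equiv.ofBijective
        (fun g => ⟨⟨g.1 * Y₀, hrep _ g.2.2⟩, hker _⟩) ⟨?_, ?_⟩)).symm
      · intro g g' hgg
        have h1 : g.1 * Y₀ = g'.1 * Y₀ := congrArg (fun Z => Z.1.1) hgg
        have h2 := congrArg intMap h1
        rw [intMap_mul, intMap_mul] at h2
        refine Subtype.ext (intMap_injective ?_)
        exact ((Matrix.isUnit_iff_isUnit_det _).mpr hY₀inj).mul_left_injective h2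
      · rintro ⟨⟨Y, hY⟩, hYv⟩
        obtain ⟨g, hg, rfl, hgS⟩ := hfactor _ Y hY hYv
        exact ⟨⟨g, hg, hgS⟩, rfl⟩
    rw [hcard]
    exact div_self (by exact_mod_cast (hS j₀).1.autNum_pos.ne')
  · intro j _ hj
    have : IsEmpty {Y : {Y : Matrix (Fin 3) (Fin 3) ℤ //
        (intMap Y)ᵀ * S j * intMap Y = (p : ℚ) • T} // (redMat p Y).mulVec v = 0} := by
      refine ⟨?_⟩
      rintro ⟨⟨Y, hY⟩, hYv⟩
      obtain ⟨g, hg, -, hgS⟩ := hfactor _ Y hY hYv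
      exact hSne j j₀ hj ⟨g, hg, hgS⟩
    simp
  · simp

end Kernel

lemma natCard_eq_sum_of_existsUnique {α ι : Type*} [Finite α] [Fintype ι] (P : ι → α → Prop)
    (h : ∀ a, ∃! i, P i a) : Nat.card α = ∑ i, Nat.card {a // P i a} := by
  rw [← Nat.card_sigma]
  refine Nat.card_congr (Equiv.ofBijective (fun x : (i : ι) × {a // P i a} => x.2.1) ⟨?_, ?_⟩).symm
  · rintro ⟨i, a, hi⟩ ⟨j, b, hj⟩ (rfl : a = b)
    obtain rfl := (h a).unique hi hj
    rfl
  · intro a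
    obtain ⟨i, hi, -⟩ := h a
    exact ⟨⟨i, a, hi⟩, rfl⟩

section Counting

variable {p : ℕ} [Fact p.Prime] {T T' A : Matrix (Fin 3) (Fin 3) ℚ} {e : ZMod p}
  {M : Matrix (Fin 3) (Fin 3) (ZMod p)} {k : ℕ} {S : Fin k → Matrix (Fin 3) (Fin 3) ℚ}

lemma ReducesToConic.existsUnique_ker (h : ReducesToConic p T e M) (hs : A.IsSymm)
    (hA : HalfIntegral A) {Y : Matrix (Fin 3) (Fin 3) ℤ} (hdet : Y.det.natAbs = p)
    (hY : (intMap Y)ᵀ * A * intMap Y = (p : ℚ) • T) :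
    ∃! t, (redMat p Y).mulVec ((M⁻¹).mulVec (conicPoint e t)) = 0 := by
  obtain ⟨v, hv0, hv⟩ := Matrix.exists_mulVec_eq_zero_iff.mpr
    (show (redMat p Y).det = 0 by
      rw [det_redMat, ZMod.intCast_zmod_eq_zero_iff_dvd, Int.natCast_dvd, hdet])
  have hMinv (w : Fin 3 → ZMod p) : M.mulVec ((M⁻¹).mulVec w) = w := by
    rw [Matrix.mulVec_mulVec, Matrix.mul_nonsing_inv _ h.2.1, Matrix.one_mulVec]
  have hMinv' (w : Fin 3 → ZMod p) : (M⁻¹).mulVec (M.mulVec w) = w := by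
    rw [Matrix.mulVec_mulVec, Matrix.nonsing_inv_mul _ h.2.1, Matrix.one_mulVec]
  obtain ⟨t, a, ha, hta⟩ := exists_eq_smul_conicPoint h.1
    (fun h0 => hv0 (by rw [← hMinv' v, h0, Matrix.mulVec_zero]))
    (h.conicForm_eq_zero_of_ker hs hA hY hv)
  have ht : (M⁻¹).mulVec (conicPoint e t) = a⁻¹ • v := by
    rw [← hMinv' v, hta, Matrix.mulVec_smul, inv_smul_smul₀ ha]
  refine ⟨t, ?_, fun s hs' => ?_⟩
  · change (redMat p Y).mulVec ((M⁻¹).mulVec (conicPoint e t)) = 0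
    rw [ht, Matrix.mulVec_smul, hv, smul_zero]
  · obtain ⟨c, hc⟩ := h.ker_le hs hA hY hv0 hv hs'
    have h1 : conicPoint e s = (c * a) • conicPoint e t := by
      rw [mul_smul, ← hta, ← Matrix.mulVec_smul, ← hc, hMinv]
    exact conicPoint_injective_of_smul h1

/-- The number of classes, weighted by automorphs, of overlattices of index `p` is `p + 1`. -/
lemma ReducesToConic.sum_repNum_div_autNum (h : ReducesToConic p T e M) (hT : PosDef3 T)
    (hTh : HalfIntegral T) (hS : ∀ j, PosDef3 (S j) ∧ HalfIntegral (S j))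
    (hSne : ∀ i j, i ≠ j → ¬ ZEquiv (S i) (S j))
    (hdet : ∀ j Y, (intMap Y)ᵀ * S j * intMap Y = (p : ℚ) • T → Y.det.natAbs = p)
    (hex : ∀ A Y, PosDef3 A → HalfIntegral A → Y.det.natAbs = p →
      (intMap Y)ᵀ * A * intMap Y = (p : ℚ) • T → ∃ j, ZEquiv A (S j)) :
    ∑ j, (repNum ((p : ℚ) • T) (S j) : ℚ) / autNum (S j) = p + 1 := by
  have hMinv (w : Fin 3 → ZMod p) : M.mulVec ((M⁻¹).mulVec w) = w := by
    rw [Matrix.mulVec_mulVec, Matrix.mul_nonsing_inv _ h.2.1, Matrix.one_mulVec]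
  have hpoint (t : Option (ZMod p)) :=
    h.sum_card_ker_div_autNum hT hTh hS hSne hdet hex (v := (M⁻¹).mulVec (conicPoint e t))
      (fun h0 => conicPoint_ne_zero e t (by rw [← hMinv (conicPoint e t), h0, Matrix.mulVec_zero]))
      (by rw [hMinv, conicForm_conicPoint])
  have hsplit (j : Fin k) := by
    have := (hS j).1.finite_rep ((p : ℚ) • T)
    exact natCard_eq_sum_of_existsUnique
      (α := {Y : Matrix (Fin 3) (Fin 3) ℤ // (intMap Y)ᵀ * S j * intMap Y = (p : ℚ) • T})
      (fun t Y => (redMat p Y).mulVec ((M⁻¹).mulVec (conicPoint e t)) = 0)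
      fun Y => h.existsUnique_ker (hS j).1.1 (hS j).2 (hdet j _ Y.2) Y.2
  simp only [repNum, hsplit, Nat.cast_sum, Finset.sum_div]
  rw [Finset.sum_comm, Finset.sum_congr rfl fun t _ => hpoint t]
  simp [ZMod.card]

/-- Overlattices of index `p` that contain the image of `p⁻¹ W`. -/
lemma ReducesToConic.sum_card_annihilator_div_autNum (h : ReducesToConic p T e M)
    (hT : PosDef3 T) (hTh : HalfIntegral T) (hs' : T'.IsSymm) (hT' : HalfIntegral T')
    (hS : ∀ j, PosDef3 (S j) ∧ HalfIntegral (S j))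
    (hSne : ∀ i j, i ≠ j → ¬ ZEquiv (S i) (S j))
    (hdet : ∀ j Y, (intMap Y)ᵀ * S j * intMap Y = (p : ℚ) • T → Y.det.natAbs = p)
    (hex : ∀ A Y, PosDef3 A → HalfIntegral A → Y.det.natAbs = p →
      (intMap Y)ᵀ * A * intMap Y = (p : ℚ) • T → ∃ j, ZEquiv A (S j))
    {W : Matrix (Fin 3) (Fin 3) ℤ} (hW : (intMap W)ᵀ * T * intMap W = (p : ℚ) ^ 2 • T') :
    ∑ j, (Nat.card {Y : {Y : Matrix (Fin 3) (Fin 3) ℤ //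
      (intMap Y)ᵀ * S j * intMap Y = (p : ℚ) • T} // redMat p Y * redMat p W = 0} : ℚ) /
        autNum (S j) = 1 + p * if redMat p W = 0 then 1 else 0 := by
  split_ifs with hW0
  · have (j : Fin k) : Nat.card {Y : {Y : Matrix (Fin 3) (Fin 3) ℤ //
        (intMap Y)ᵀ * S j * intMap Y = (p : ℚ) • T} // redMat p Y * redMat p W = 0} =
          repNum ((p : ℚ) • T) (S j) :=
      Nat.card_congr (Equiv.subtypeUnivEquiv fun _ => by rw [hW0, Matrix.mul_zero])
    simp only [this]
    rw [h.sum_repNum_div_autNum hT hTh hS hSne hdet hex]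
    ring
  · have hiso (z : Fin 3 → ZMod p) : conicForm e (M.mulVec ((redMat p W).mulVec z)) = 0 := by
      obtain ⟨x, rfl⟩ := exists_lift p z
      obtain ⟨n, hn⟩ := hT'.exists_qf_eq hs' x
      have h1 : qf T (W.mulVec x) = ((p ^ 2 * n : ℤ) : ℚ) := by
        rw [qf_mulVec, hW, qf_smul, hn]
        push_cast
        rfl
      rw [redMat_mulVec]
      exact (h.dvd_iff h1).mp (Dvd.dvd.mul_right (dvd_pow_self _ two_ne_zero) _)
    obtain ⟨c, hc⟩ : ∃ c, (redMat p W).mulVec (Pi.single c 1) ≠ 0 := by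
      by_contra! hall
      refine hW0 ?_
      ext i j
      simpa using congrFun (hall j) i
    have hiff (Y : Matrix (Fin 3) (Fin 3) (ZMod p)) :
        Y * redMat p W = 0 ↔ Y.mulVec ((redMat p W).mulVec (Pi.single c 1)) = 0 := by
      constructor
      · intro h0
        rw [Matrix.mulVec_mulVec, h0, Matrix.zero_mulVec]
      · intro h0
        ext i j
        obtain ⟨a, ha⟩ := h.exists_eq_smul hc (hiso _) (hiso (Pi.single j 1))
          (by rw [← Matrix.mulVec_add]; exact hiso _)
        have h1 : Y.mulVec ((redMat p W).mulVec (Pi.single j 1)) = 0 := by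
          rw [ha, Matrix.mulVec_smul, h0, smul_zero]
        rw [Matrix.mulVec_mulVec] at h1
        simpa using congrFun h1 i
    simp only [hiff]
    rw [h.sum_card_ker_div_autNum hT hTh hS hSne hdet hex hc (hiso _)]
    ring

/-- Pairs of representations by `A` correspond to representations of `p² T'` by `T` together
with an intermediate representation. -/
lemma repNum_mul_repNum (hA : PosDef3 A)
    (hdet : ∀ Y, (intMap Y)ᵀ * A * intMap Y = (p : ℚ) • T → Y.det.natAbs = p)
    [Fintype {W : Matrix (Fin 3) (Fin 3) ℤ // (intMap W)ᵀ * T * intMap W = (p : ℚ) ^ 2 • T'}] :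
    repNum ((p : ℚ) • T') A * repNum ((p : ℚ) • T) A =
      ∑ W : {W : Matrix (Fin 3) (Fin 3) ℤ // (intMap W)ᵀ * T * intMap W = (p : ℚ) ^ 2 • T'},
        Nat.card {Y : {Y : Matrix (Fin 3) (Fin 3) ℤ //
          (intMap Y)ᵀ * A * intMap Y = (p : ℚ) • T} // redMat p Y * redMat p W = 0} := by
  have hp0 : p ≠ 0 := (Fact.out : p.Prime).ne_zero
  have hpz : (p : ℤ) ≠ 0 := by exact_mod_cast hp0
  have hpq : (p : ℚ) ≠ 0 := by exact_mod_cast hp0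
  have hfin := hA.finite_rep ((p : ℚ) • T)
  have hex (Y W : Matrix (Fin 3) (Fin 3) ℤ) (hYW : redMat p Y * redMat p W = 0) :
      ∃ X, Y * W = (p : ℤ) • X := by
    rwa [← redMat_mul, redMat_eq_zero_iff] at hYW
  have hgram (X Y W : Matrix (Fin 3) (Fin 3) ℤ) (hYWX : Y * W = (p : ℤ) • X)
      (hY : (intMap Y)ᵀ * A * intMap Y = (p : ℚ) • T) :
      (p : ℚ) ^ 2 • ((intMap X)ᵀ * A * intMap X) =
        (p : ℚ) • ((intMap W)ᵀ * T * intMap W) := by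
    have h1 : intMap Y * intMap W = (p : ℚ) • intMap X := by
      rw [← intMap_mul, hYWX, intMap_smul, Int.cast_natCast]
    have h2 : (intMap W)ᵀ * ((intMap Y)ᵀ * A * intMap Y) * intMap W =
        ((p : ℚ) • intMap X)ᵀ * A * ((p : ℚ) • intMap X) := by
      rw [← h1, Matrix.transpose_mul]
      simp only [Matrix.mul_assoc]
    rw [hY] at h2
    simp only [Matrix.transpose_smul, Matrix.mul_smul, Matrix.smul_mul, smul_smul] at h2
    rw [h2, sq]
  have hcancel (X X' : Matrix (Fin 3) (Fin 3) ℤ) (h : (p : ℤ) • X = (p : ℤ) • X') : X = X' :=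
    smul_right_injective _ hpz h
  choose f hf using hex
  rw [← Nat.card_sigma, repNum, repNum, ← Nat.card_prod]
  have hrep (W Y : Matrix (Fin 3) (Fin 3) ℤ) (hW : (intMap W)ᵀ * T * intMap W = (p : ℚ) ^ 2 • T')
      (hY : (intMap Y)ᵀ * A * intMap Y = (p : ℚ) • T) (hYW : redMat p Y * redMat p W = 0) :
      (intMap (f Y W hYW))ᵀ * A * intMap (f Y W hYW) = (p : ℚ) • T' := by
    refine smul_right_injective _ (pow_ne_zero 2 hpq) ((hgram _ Y W (hf Y W hYW) hY).trans ?_)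
    change (p : ℚ) • _ = (p : ℚ) ^ 2 • (p : ℚ) • T'
    rw [hW, smul_comm]
  refine (Nat.card_congr (Equiv.ofBijective
    (fun x => ⟨⟨f x.2.1.1 x.1.1 x.2.2, hrep _ _ x.1.2 x.2.1.2 x.2.2⟩, x.2.1⟩) ⟨?_, ?_⟩)).symm
  · rintro ⟨⟨W, hW⟩, ⟨⟨Y, hY⟩, hYW⟩⟩ ⟨⟨W', hW'⟩, ⟨⟨Y', hY'⟩, hYW'⟩⟩ h
    obtain rfl : Y = Y' := congrArg (fun z => z.2.1) h
    have hX : f Y W hYW = f Y W' hYW' := congrArg (fun z => z.1.1) h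
    have hdetY : Y.det ≠ 0 := by
      rw [← Int.natAbs_ne_zero, hdet Y hY]
      exact hp0
    have hWW : Y.adjugate * (Y * W) = Y.adjugate * (Y * W') := by
      rw [hf Y W hYW, hf Y W' hYW', hX]
    rw [← Matrix.mul_assoc, ← Matrix.mul_assoc, Matrix.adjugate_mul, Matrix.smul_mul,
      Matrix.smul_mul, Matrix.one_mul, Matrix.one_mul] at hWW
    obtain rfl : W = W' := smul_right_injective _ hdetY hWW
    rfl
  · rintro ⟨⟨X, hX⟩, ⟨Y, hY⟩⟩
    obtain ⟨s, hs⟩ : ∃ s : ℤ, s * Y.det = p := by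
      rcases Int.natAbs_eq Y.det with h | h <;> rw [hdet Y hY] at h
      · exact ⟨1, by rw [h, one_mul]⟩
      · exact ⟨-1, by rw [h, neg_mul_neg, one_mul]⟩
    have hYWX : Y * (s • (Y.adjugate * X)) = (p : ℤ) • X := by
      rw [Matrix.mul_smul, ← Matrix.mul_assoc, Matrix.mul_adjugate, Matrix.smul_mul,
        Matrix.one_mul, smul_smul, hs]
    have hYW : redMat p Y * redMat p (s • (Y.adjugate * X)) = 0 := by
      rw [← redMat_mul, redMat_eq_zero_iff]
      exact ⟨X, hYWX⟩
    have hW := hgram X Y _ hYWX hY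
    rw [hX, smul_comm] at hW
    exact ⟨⟨⟨_, (smul_right_injective _ hpq hW).symm⟩, ⟨⟨Y, hY⟩, hYW⟩⟩,
      Prod.ext (Subtype.ext (hcancel _ _ ((hf Y _ hYW).symm.trans hYWX))) rfl⟩

lemma natCard_redMat_eq_zero :
    Nat.card {W : {W : Matrix (Fin 3) (Fin 3) ℤ //
      (intMap W)ᵀ * T * intMap W = (p : ℚ) ^ 2 • T'} // redMat p W.1 = 0} = repNum T' T := by
  have hp0 : p ≠ 0 := (Fact.out : p.Prime).ne_zero
  have hpz : (p : ℤ) ≠ 0 := by exact_mod_cast hp0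
  have hpq : (p : ℚ) ^ 2 ≠ 0 := by exact_mod_cast pow_ne_zero 2 hp0
  have hgram (U : Matrix (Fin 3) (Fin 3) ℤ) :
      (intMap ((p : ℤ) • U))ᵀ * T * intMap ((p : ℤ) • U) =
        (p : ℚ) ^ 2 • ((intMap U)ᵀ * T * intMap U) := by
    rw [intMap_smul, Int.cast_natCast]
    simp only [Matrix.transpose_smul, Matrix.mul_smul, Matrix.smul_mul, smul_smul]
    rw [sq]
  refine (Nat.card_congr (Equiv.ofBijective (fun U => ⟨⟨(p : ℤ) • U.1, (hgram U.1).trans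
    (congrArg _ U.2)⟩, redMat_eq_zero_iff.mpr ⟨U.1, rfl⟩⟩) ⟨?_, ?_⟩)).symm
  · intro U V hUV
    exact Subtype.ext (smul_right_injective _ hpz (congrArg (fun Z => Z.1.1) hUV))
  · rintro ⟨⟨W, hW⟩, hW0⟩
    obtain ⟨U, rfl⟩ := redMat_eq_zero_iff.mp hW0
    exact ⟨⟨U, smul_right_injective _ hpq ((hgram U).symm.trans hW)⟩, rfl⟩

/-- The Eichler relation between the two Anzahlmatrices, in unnormalised form. -/
lemma ReducesToConic.sum_repNum_mul_repNum (h : ReducesToConic p T e M)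
    (hT : PosDef3 T) (hTh : HalfIntegral T) (hs' : T'.IsSymm) (hT' : HalfIntegral T')
    (hS : ∀ j, PosDef3 (S j) ∧ HalfIntegral (S j))
    (hSne : ∀ i j, i ≠ j → ¬ ZEquiv (S i) (S j))
    (hdet : ∀ j Y, (intMap Y)ᵀ * S j * intMap Y = (p : ℚ) • T → Y.det.natAbs = p)
    (hex : ∀ A Y, PosDef3 A → HalfIntegral A → Y.det.natAbs = p →
      (intMap Y)ᵀ * A * intMap Y = (p : ℚ) • T → ∃ j, ZEquiv A (S j)) :
    ∑ j, (repNum ((p : ℚ) • T') (S j) * repNum ((p : ℚ) • T) (S j) : ℚ) / autNum (S j) =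
      repNum ((p : ℚ) ^ 2 • T') T + p * repNum T' T := by
  have := hT.finite_rep ((p : ℚ) ^ 2 • T')
  let _ := Fintype.ofFinite {W : Matrix (Fin 3) (Fin 3) ℤ //
    (intMap W)ᵀ * T * intMap W = (p : ℚ) ^ 2 • T'}
  have hprod (j : Fin k) := congrArg (Nat.cast (R := ℚ))
    (repNum_mul_repNum (T' := T') (hS j).1 (hdet j))
  push_cast at hprod
  simp only [hprod, Finset.sum_div]
  rw [Finset.sum_comm, Finset.sum_congr rfl fun W _ =>
    h.sum_card_annihilator_div_autNum hT hTh hs' hT' hS hSne hdet hex W.2,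
    Finset.sum_add_distrib, ← Finset.mul_sum, Finset.sum_boole,
    ← natCard_redMat_eq_zero (p := p) (T := T) (T' := T'),
    Nat.subtype_card (Finset.univ.filter fun W => redMat p W.1 = 0) (by simp)]
  simp [repNum]

end Counting

section Genus

/-- If `B = Yᵀ A Y` and `det B` is locally `n² det A` up to units, then `det Y = ± n`. -/
lemma natAbs_det_eq_of_norm_det {n : ℕ} (hn : n ≠ 0) {A B : Matrix (Fin 3) (Fin 3) ℚ}
    {Y : Matrix (Fin 3) (Fin 3) ℤ} (hB : B.det ≠ 0) (hY : (intMap Y)ᵀ * A * intMap Y = B)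
    (h : ∀ q : ℕ, ∀ hq : q.Prime, haveI := Fact.mk hq;
      ‖(B.det : ℚ_[q])‖ = ‖(n : ℚ_[q])‖ ^ 2 * ‖(A.det : ℚ_[q])‖) : Y.det.natAbs = n := by
  have hdet : (Y.det : ℚ) ^ 2 * A.det = B.det := by
    rw [← hY, Matrix.det_mul, Matrix.det_mul, Matrix.det_transpose, det_intMap]
    ring
  have hA : A.det ≠ 0 := fun h0 => hB (by rw [← hdet, h0, mul_zero])
  have hYdet : Y.det ≠ 0 := by
    rintro h0
    exact hB (by rw [← hdet, h0]; simp)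
  rw [Int.natAbs_eq_of_padic_norm_eq hYdet (b := n) (by exact_mod_cast hn) ?_, Int.natAbs_natCast]
  intro q hq
  have := Fact.mk hq
  have h1 := h q hq
  rw [← hdet, Rat.cast_mul, Rat.cast_pow, norm_mul, norm_pow, Rat.cast_intCast] at h1
  have h2 := mul_right_cancel₀ (norm_ne_zero_iff.mpr (Rat.cast_ne_zero.mpr hA)) h1
  rw [Int.cast_natCast]
  exact (pow_left_inj₀ (norm_nonneg _) (norm_nonneg _) two_ne_zero).mp h2

lemma det_smul_three (a : ℚ) (A : Matrix (Fin 3) (Fin 3) ℚ) : (a • A).det = a ^ 3 * A.det := by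
  rw [Matrix.det_smul, Fintype.card_fin]

/-- Representations within a genus are isometries. -/
lemma isUnit_det_of_rep {A B : Matrix (Fin 3) (Fin 3) ℚ} {Y : Matrix (Fin 3) (Fin 3) ℤ}
    (hB : PosDef3 B) (hloc : ∀ q : ℕ, ∀ hq : q.Prime, @ZqEquiv q ⟨hq⟩ A B)
    (hY : (intMap Y)ᵀ * A * intMap Y = B) : IsUnit Y.det := by
  refine Int.isUnit_iff_natAbs_eq.mpr
    (natAbs_det_eq_of_norm_det one_ne_zero hB.isUnit_det.ne_zero hY fun q hq => ?_)
  have := Fact.mk hq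
  rw [(hloc q hq).norm_det_eq]
  simp

lemma repNum_eq_ite {ι : Type*} [DecidableEq ι] {T : ι → Matrix (Fin 3) (Fin 3) ℚ}
    (hT : ∀ i, PosDef3 (T i)) (hTne : ∀ i j, i ≠ j → ¬ ZEquiv (T i) (T j))
    (hTloc : ∀ i j, ∀ q : ℕ, ∀ hq : q.Prime, @ZqEquiv q ⟨hq⟩ (T i) (T j)) (i l : ι) :
    repNum (T i) (T l) = if i = l then autNum (T i) else 0 := by
  split_ifs with hil
  · subst hil
    exact Nat.card_congr (Equiv.subtypeEquivRight fun X =>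
      ⟨fun h => ⟨isUnit_det_of_rep (hT i) (hTloc i i) h, h⟩, And.right⟩)
  · have : IsEmpty {X : Matrix (Fin 3) (Fin 3) ℤ // (intMap X)ᵀ * T l * intMap X = T i} :=
      ⟨fun X => hTne l i (Ne.symm hil)
        ⟨X.1, isUnit_det_of_rep (hT i) (hTloc l i) X.2, X.2⟩⟩
    exact Nat.card_of_isEmpty

lemma natAbs_det_eq_of_rep_smul {p : ℕ} [Fact p.Prime] {ε : ℤ_[p]ˣ}
    {A T T₀ : Matrix (Fin 3) (Fin 3) ℚ} {Y : Matrix (Fin 3) (Fin 3) ℤ} (hT : PosDef3 T)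
    (hTp : ZpEquivTo p T (Hblock p ((ε : ℤ_[p]) : ℚ_[p])))
    (hTloc : ∀ q : ℕ, ∀ hq : q.Prime, @ZqEquiv q ⟨hq⟩ T T₀)
    (hAp : ZpEquivTo p A (Hblock p ((p : ℚ_[p]) * ((ε : ℤ_[p]) : ℚ_[p]))))
    (hAloc : ∀ q : ℕ, ∀ hq : q.Prime, q ≠ p → @ZqEquiv q ⟨hq⟩ A ((p : ℚ) • T₀))
    (hY : (intMap Y)ᵀ * A * intMap Y = (p : ℚ) • T) : Y.det.natAbs = p := by
  have hp : p.Prime := Fact.out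
  refine natAbs_det_eq_of_norm_det hp.ne_zero
    (hT.smul (by exact_mod_cast hp.pos)).isUnit_det.ne_zero hY fun q hq => ?_
  have := Fact.mk hq
  rw [det_smul_three, Rat.cast_mul, norm_mul, Rat.cast_pow, norm_pow, Rat.cast_natCast]
  by_cases hqp : q = p
  · subst hqp
    rw [hTp.norm_det_eq, hAp.norm_det_eq, det_Hblock, det_Hblock, mul_div_assoc, norm_neg,
      norm_neg, norm_mul]
    ring
  · rw [(hAloc q hq hqp).norm_det_eq, (hTloc q hq).norm_det_eq, det_smul_three, Rat.cast_mul,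
      norm_mul, Rat.cast_pow, norm_pow, Rat.cast_natCast,
      Padic.norm_natCast_eq_one_iff.mpr ((Nat.coprime_primes hq hp).mpr hqp)]
    ring

end Genus

/-- For `D` a positive diagonal matrix, `M D Mᵀ` is singular exactly when the rows of `M` are
linearly dependent. -/
lemma det_mul_diagonal_mul_transpose_eq_zero_iff {m n : ℕ} (M : Matrix (Fin m) (Fin n) ℚ)
    {d : Fin n → ℚ} (hd : ∀ j, 0 < d j) :
    (M * Matrix.diagonal d * Mᵀ).det = 0 ↔ M.rank < m := by
  have hrank : M.rank < m ↔ ∃ x, x ≠ 0 ∧ x ᵥ* M = 0 := by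
    have hli : M.rank = m ↔ LinearIndependent ℚ M.row := by
      rw [linearIndependent_iff_card_eq_finrank_span, Matrix.rank_eq_finrank_span_row,
        Fintype.card_fin, Set.finrank, eq_comm]
    rw [(Matrix.rank_le_height M).lt_iff_ne, Ne, hli, ← Matrix.vecMul_injective_iff]
    refine ⟨fun h => ?_, fun ⟨x, hx, hM⟩ h => hx (h (hM.trans (Matrix.zero_vecMul M).symm))⟩
    by_contra! h0
    refine h fun x y hxy => ?_
    by_contra hne
    exact h0 (x - y) (sub_ne_zero.mpr hne) (by rw [Matrix.sub_vecMul]; exact sub_eq_zero.mpr hxy)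
  rw [hrank, ← Matrix.exists_vecMul_eq_zero_iff]
  refine exists_congr fun x => and_congr_right fun _ => ⟨fun h => ?_, fun h => ?_⟩
  · have h1 : ∑ j, (x ᵥ* M) j * d j * (x ᵥ* M) j = 0 := by
      have h2 : (x ᵥ* (M * Matrix.diagonal d * Mᵀ)) ⬝ᵥ x = 0 := by rw [h, zero_dotProduct]
      rw [← Matrix.vecMul_vecMul, ← Matrix.vecMul_vecMul, Matrix.vecMul_transpose,
        dotProduct_comm, Matrix.dotProduct_mulVec, dotProduct_comm] at h2
      simpa [dotProduct, Matrix.vecMul_diagonal] using h2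
    ext j
    have h3 := (Finset.sum_eq_zero_iff_of_nonneg fun j _ => by
      rw [mul_right_comm]
      exact mul_nonneg (mul_self_nonneg _) (hd j).le).mp h1 j (Finset.mem_univ j)
    simpa [(hd j).ne'] using h3
  · rw [← Matrix.vecMul_vecMul, ← Matrix.vecMul_vecMul, h, Matrix.zero_vecMul, Matrix.zero_vecMul]

/-- In the Eichler Anzahlmatrix setting (complete genus representatives `T₁,…,T_h` and
`S₁,…,S_k` as in the Anzahlmatrix relation), the matrix
`π = (r(pT_i,T_j)/o(T_i) − δ_{ij})` has `−(p+1)` as an eigenvalue (equivalently,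
`det(π + (p+1)I) = 0`) if and only if `𝔐 = (r(T_i^p,S_j)/o(T_i))` has rank `< h`. -/
theorem stmt_10 (p : ℕ) [Fact p.Prime] (ε : ℤ_[p]ˣ)
    (h k : ℕ) (hh : 0 < h)
    (T : Fin h → Matrix (Fin 3) (Fin 3) ℚ) (S : Fin k → Matrix (Fin 3) (Fin 3) ℚ)
    (hT : ∀ i, PosDef3 (T i) ∧ HalfIntegral (T i))
    (hTne : ∀ i j, i ≠ j → ¬ ZEquiv (T i) (T j))
    (hTloc : ∀ i j, ∀ q : ℕ, ∀ hq : q.Prime, @ZqEquiv q ⟨hq⟩ (T i) (T j))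
    (hTp : ∀ i, ZpEquivTo p (T i) (Hblock p ((ε : ℤ_[p]) : ℚ_[p])))
    (hTcomp : ∀ A : Matrix (Fin 3) (Fin 3) ℚ, PosDef3 A → HalfIntegral A →
      (∀ q : ℕ, ∀ hq : q.Prime, @ZqEquiv q ⟨hq⟩ A (T ⟨0, hh⟩)) → ∃ i, ZEquiv A (T i))
    (hS : ∀ j, PosDef3 (S j) ∧ HalfIntegral (S j))
    (hSne : ∀ i j, i ≠ j → ¬ ZEquiv (S i) (S j))
    (hSp : ∀ j, ZpEquivTo p (S j) (Hblock p ((p : ℚ_[p]) * ((ε : ℤ_[p]) : ℚ_[p]))))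
    (hSloc : ∀ j, ∀ q : ℕ, ∀ hq : q.Prime, q ≠ p →
      @ZqEquiv q ⟨hq⟩ (S j) ((p : ℚ) • T ⟨0, hh⟩))
    (hScomp : ∀ A : Matrix (Fin 3) (Fin 3) ℚ, PosDef3 A → HalfIntegral A →
      ZpEquivTo p A (Hblock p ((p : ℚ_[p]) * ((ε : ℤ_[p]) : ℚ_[p]))) →
      (∀ q : ℕ, ∀ hq : q.Prime, q ≠ p → @ZqEquiv q ⟨hq⟩ A ((p : ℚ) • T ⟨0, hh⟩)) →
      ∃ j, ZEquiv A (S j))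
    (Pi : Matrix (Fin h) (Fin h) ℚ)
    (hPi : Pi = Matrix.of fun i j =>
      (repNum ((p : ℚ) ^ 2 • T i) (T j) : ℚ) / (autNum (T i) : ℚ) - if i = j then 1 else 0)
    (MM : Matrix (Fin h) (Fin k) ℚ)
    (hMM : MM = Matrix.of fun i j =>
      (repNum ((p : ℚ) • T i) (S j) : ℚ) / (autNum (T i) : ℚ)) :
    (Pi + ((p : ℚ) + 1) • (1 : Matrix (Fin h) (Fin h) ℚ)).det = 0 ↔ MM.rank < h := by
  have hp : p.Prime := Fact.out
  have hp0 : (0 : ℚ) < p := by exact_mod_cast hp.pos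
  have ho (i : Fin h) : (autNum (T i) : ℚ) ≠ 0 := by
    exact_mod_cast (hT i).1.autNum_pos.ne'
  have hrel (i l : Fin h) : ∑ j, (repNum ((p : ℚ) • T i) (S j) *
      repNum ((p : ℚ) • T l) (S j) : ℚ) / autNum (S j) =
        repNum ((p : ℚ) ^ 2 • T i) (T l) + p * repNum (T i) (T l) := by
    obtain ⟨e, M, hM⟩ := exists_reducesToConic (hTp l)
    refine hM.sum_repNum_mul_repNum (hT l).1 (hT l).2 (hT i).1.1 (hT i).2 hS hSne
      (fun j Y hY => natAbs_det_eq_of_rep_smul (hT l).1 (hTp l) (hTloc l ⟨0, hh⟩) (hSp j)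
        (hSloc j) hY)
      fun A Y hA hAh hdet hY => hScomp A hA hAh
        (zpEquivTo_Hblock_of_index_p hA.1 hAh hdet hY (hTp l)) fun q hq hqp => ?_
    have := Fact.mk hq
    exact (zqEquiv_of_index_p hp hqp hdet hY).trans_zpEquivTo
      (zqEquiv_iff.mp ((hTloc l ⟨0, hh⟩ q hq).smul p))
  have hmul : MM * Matrix.diagonal (fun j => (autNum (S j) : ℚ)⁻¹) * MMᵀ =
      (Pi + ((p : ℚ) + 1) • (1 : Matrix (Fin h) (Fin h) ℚ)) *
        Matrix.diagonal fun i => (autNum (T i) : ℚ)⁻¹ := by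
    ext i l
    have hleft : (MM * Matrix.diagonal (fun j => (autNum (S j) : ℚ)⁻¹) * MMᵀ) i l =
        (∑ j, (repNum ((p : ℚ) • T i) (S j) * repNum ((p : ℚ) • T l) (S j) : ℚ) /
          autNum (S j)) / (autNum (T i) * autNum (T l)) := by
      rw [Matrix.mul_apply, Finset.sum_div]
      refine Finset.sum_congr rfl fun j _ => ?_
      rw [Matrix.mul_diagonal, Matrix.transpose_apply, hMM, Matrix.of_apply, Matrix.of_apply]
      ring
    rw [hleft, hrel, repNum_eq_ite (fun i => (hT i).1) hTne hTloc, Matrix.mul_diagonal,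
      Matrix.add_apply, Matrix.smul_apply, Matrix.one_apply, hPi, Matrix.of_apply]
    have hi := ho i
    have hl := ho l
    split_ifs with hil
    · subst hil
      field_simp
      ring
    · field_simp
      simp
  have hdet : (Matrix.diagonal fun i => (autNum (T i) : ℚ)⁻¹).det ≠ 0 := by
    rw [Matrix.det_diagonal]
    exact Finset.prod_ne_zero_iff.mpr fun i _ => inv_ne_zero (ho i)
  rw [← det_mul_diagonal_mul_transpose_eq_zero_iff MM
    (d := fun j => (autNum (S j) : ℚ)⁻¹)
    (fun j => inv_pos.mpr (by exact_mod_cast (hS j).1.autNum_pos)), hmul, Matrix.det_mul,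
    mul_eq_zero, or_iff_left hdet]
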